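/- Let W be a two-parameter Brownian motion on [0,1]² and let f : ℝ → ℝ be bounded and measurable. Fix (s,t) ∈ [0,1]² and for n ≥ 1 let Xⁿ_{(s,t)} := n Σ_{i=1}^{⌊ns⌋} Σ_{j=1}^{⌊nt⌋} f(W_{((i-1)/n,(j-1)/n)}) (|Δ_{i,j}W|² − 1/n²). Then for every bounded real random variable Z on (Ω,F,P) and every u ∈ ℝ, E[Z · exp(i u Xⁿ_{(s,t)})] converges as n → ∞ to E[Z · exp(−u² ∫_{[0,s]×[0,t]} f(W_ρ)² dρ)]. (This is the F-stable convergence in law of Xⁿ_{(s,t)} to √2 ∫_{[0,s]×[0,t]} f(W_ρ) dB_ρ, where B is a two-parameter Brownian motion independent of W, defined on a very good extension of the probability basis.) -/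

import Mathlib

open MeasureTheory ProbabilityTheory Filter Topology

/-- A two-parameter Brownian motion (Brownian sheet) on `[0,1]²`: a measurable process with
almost surely continuous sample paths whose finite-dimensional distributions are centered
Gaussian with covariance `E[W_(s,t) W_(s',t')] = (s ∧ s')(t ∧ t')`.  Joint Gaussianity is
encoded through the one-dimensional distributions of all linear combinations. -/
def IsBrownianSheet {Ω : Type*} [MeasurableSpace Ω] (P : Measure Ω)
    (W : ℝ × ℝ → Ω → ℝ) : Prop :=
  (∀ z, Measurable (W z)) ∧
  (∀ᵐ ω ∂P, Continuous fun z => W z ω) ∧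
  ∀ (m : ℕ) (z : Fin m → ℝ × ℝ), (∀ k, z k ∈ Set.Icc ((0:ℝ), (0:ℝ)) (1, 1)) →
    ∀ c : Fin m → ℝ,
      Measure.map (fun ω => ∑ k, c k * W (z k) ω) P =
        gaussianReal 0 (Real.toNNReal (∑ k, ∑ k', c k * c k' *
          (min (z k).1 (z k').1 * min (z k).2 (z k').2)))

/-- The weighted quadratic variations process
`Xⁿ_(s,t) = n ∑_{i=1}^{⌊ns⌋} ∑_{j=1}^{⌊nt⌋} f(W_((i-1)/n,(j-1)/n)) (|Δ_{i,j}W|² - 1/n²)`. -/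
noncomputable def wqv {Ω : Type*} (W : ℝ × ℝ → Ω → ℝ) (f : ℝ → ℝ) (n : ℕ)
    (s t : ℝ) (ω : Ω) : ℝ :=
  n * ∑ i ∈ Finset.Icc 1 (Nat.floor ((n : ℝ) * s)),
      ∑ j ∈ Finset.Icc 1 (Nat.floor ((n : ℝ) * t)),
    f (W (((i : ℝ) - 1) / n, ((j : ℝ) - 1) / n) ω) *
      ((W (((i : ℝ) - 1) / n, ((j : ℝ) - 1) / n) ω + W ((i : ℝ) / n, (j : ℝ) / n) ω
          - W (((i : ℝ) - 1) / n, (j : ℝ) / n) ω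
          - W ((i : ℝ) / n, ((j : ℝ) - 1) / n) ω) ^ 2
        - 1 / (n : ℝ) ^ 2)

lemma iteratedDeriv_exp_sq_half (g : ℝ → ℝ) (hg : g = fun t => Real.exp (t ^ 2 / 2)) :
    iteratedDeriv 2 g 0 = 1 ∧ iteratedDeriv 3 g 0 = 0 ∧ iteratedDeriv 4 g 0 = 3 := by
  have hd : ∀ p q : ℝ → ℝ, (∀ t, HasDerivAt p (q t) t) →
      deriv (fun t => p t * g t) = fun t => (q t + t * p t) * g t := by
    intro p q hpq
    funext t
    have h1 : HasDerivAt g (Real.exp (t ^ 2 / 2) * (t)) t := by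
      rw [hg]
      refine HasDerivAt.exp ?_
      exact ((hasDerivAt_pow 2 t).div_const 2).congr_deriv (by norm_num)
    rw [((hpq t).fun_mul h1).deriv, hg]
    ring
  have e1 : deriv g = fun t => t * g t := by
    have := hd (fun _ => 1) (fun _ => 0) (fun t => hasDerivAt_const t 1)
    simpa using this
  have e2 : deriv (fun t => t * g t) = fun t => (1 + t * t) * g t :=
    hd (fun t => t) (fun _ => 1) (fun t => hasDerivAt_id t)
  have e3 : deriv (fun t => (1 + t * t) * g t) = fun t => (2 * t + t * (1 + t * t)) * g t := by
    refine hd (fun t => 1 + t * t) (fun t => 2 * t) (fun t => ?_)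
    exact (((hasDerivAt_id' t).fun_mul (hasDerivAt_id' t)).const_add 1).congr_deriv (by ring)
  have e4 : deriv (fun t => (2 * t + t * (1 + t * t)) * g t) =
      fun t => ((3 + 3 * t ^ 2) + t * (2 * t + t * (1 + t * t))) * g t := by
    refine hd (fun t => 2 * t + t * (1 + t * t)) (fun t => 3 + 3 * t ^ 2) (fun t => ?_)
    exact (((hasDerivAt_id' t).const_mul 2).fun_add ((hasDerivAt_id' t).fun_mul
      (((hasDerivAt_id' t).fun_mul (hasDerivAt_id' t)).const_add 1))).congr_deriv (by ring)
  have hg0 : g 0 = 1 := by simp [hg]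
  refine ⟨?_, ?_, ?_⟩ <;>
    simp only [iteratedDeriv_succ, iteratedDeriv_zero, e1, e2, e3, e4] <;> simp [hg0]

lemma gaussianReal_moments :
    (∫ y, y ^ 2 ∂gaussianReal 0 1 = 1) ∧ (∫ y, y ^ 3 ∂gaussianReal 0 1 = 0) ∧
      (∫ y, y ^ 4 ∂gaussianReal 0 1 = 3) := by
  have hm : mgf id (gaussianReal 0 1) = fun t => Real.exp (t ^ 2 / 2) := by
    rw [mgf_id_gaussianReal]; simp
  have h0 : (0 : ℝ) ∈ interior (integrableExpSet id (gaussianReal 0 1)) := by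
    rw [integrableExpSet_id_gaussianReal]; simp
  have hk := fun n => iteratedDeriv_mgf_zero (μ := gaussianReal 0 1) (X := id) h0 n
  obtain ⟨h2, h3, h4⟩ := iteratedDeriv_exp_sq_half _ hm
  rw [hk] at h2 h3 h4
  exact ⟨by simpa using h2, by simpa using h3, by simpa using h4⟩

lemma integrable_pow_gaussianReal (n : ℕ) :
    Integrable (fun y : ℝ => y ^ n) (gaussianReal 0 1) := by
  have := (memLp_id_gaussianReal (μ := 0) (v := 1) (n : NNReal)).integrable_norm_pow'
  refine this.mono (by fun_prop) (ae_of_all _ fun y => by simp)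

lemma norm_cexp_I_sub_taylor_two (x : ℝ) :
    ‖Complex.exp (x * Complex.I) - (1 + x * Complex.I - (x : ℂ) ^ 2 / 2)‖ ≤ 4 * |x| ^ 3 := by
  have hx : ‖(x : ℂ) * Complex.I‖ = |x| := by simp
  rcases le_total |x| 1 with h | h
  · have := Complex.exp_bound (x := (x : ℂ) * Complex.I) (by rw [hx]; exact h) (n := 3)
      (by norm_num)
    rw [hx] at this
    have e : ∑ m ∈ Finset.range 3, ((x : ℂ) * Complex.I) ^ m / (m.factorial : ℂ)
        = 1 + x * Complex.I - (x : ℂ) ^ 2 / 2 := by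
      simp [Finset.sum_range_succ, mul_pow, Nat.factorial]; ring
    rw [e] at this
    refine this.trans ?_
    rw [mul_comm]
    gcongr
    norm_num [Nat.factorial]
  · have h1 : ‖Complex.exp (x * Complex.I)‖ = 1 := Complex.norm_exp_ofReal_mul_I x
    have h2 : ‖(1 + x * Complex.I - (x : ℂ) ^ 2 / 2)‖ ≤ 1 + |x| + |x| ^ 2 / 2 := by
      refine (norm_sub_le _ _).trans ?_
      gcongr
      · refine (norm_add_le _ _).trans ?_
        rw [hx]; simp
      · simp
    refine (norm_sub_le _ _).trans ?_
    rw [h1]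
    nlinarith [pow_le_pow_right₀ h (show 1 ≤ 3 by norm_num),
      pow_le_pow_right₀ h (show 2 ≤ 3 by norm_num), one_le_pow₀ h (n := 3), pow_one |x|]

/-- One-step estimate: the characteristic function of `ε (b y + v (y² - 1))` under the standard
Gaussian law, compensated in the quadratic part, up to third order in `ε`. -/
lemma exists_norm_gaussian_step_le (B V : ℝ) : ∃ κ : ℝ, 0 ≤ κ ∧ ∀ ε b v : ℝ, 0 ≤ ε → ε ≤ 1 →
    |b| ≤ B → |v| ≤ V →
    ‖∫ y, (Complex.exp (((ε * (b * y + v * (y ^ 2 - 1)) : ℝ) : ℂ) * Complex.I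
        + ((ε ^ 2 * v ^ 2 : ℝ) : ℂ)) - ((Real.exp (-(ε ^ 2 * b ^ 2 / 2)) : ℝ) : ℂ))
      ∂gaussianReal 0 1‖ ≤ κ * ε ^ 3 := by
  let γ := gaussianReal 0 1
  obtain ⟨m2, m3, m4⟩ := gaussianReal_moments
  have ip := integrable_pow_gaussianReal
  let M : ℝ → ℝ := fun y => (B * (1 + y ^ 2) + V * (y ^ 2 + 1)) ^ 3
  have hM : Integrable M γ := by
    have : M = fun y => (B + V) ^ 3 * (y ^ 6 + 3 * y ^ 4 + 3 * y ^ 2 + y ^ 0) := by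
      funext y; simp only [M]; ring
    rw [this]
    exact ((((ip 6).add ((ip 4).const_mul 3)).add ((ip 2).const_mul 3)).add (ip 0)).const_mul _
  refine ⟨Real.exp (V ^ 2) * (4 * |∫ y, M y ∂γ| + (B ^ 2 / 2 + V ^ 2) ^ 2), by positivity, ?_⟩
  intro ε b v hε hε1 hb hv
  have hB : 0 ≤ B := (abs_nonneg _).trans hb
  have hV : 0 ≤ V := (abs_nonneg _).trans hv
  have hb2 : b ^ 2 ≤ B ^ 2 := sq_le_sq' (abs_le.1 hb).1 (abs_le.1 hb).2
  have hv2 : v ^ 2 ≤ V ^ 2 := sq_le_sq' (abs_le.1 hv).1 (abs_le.1 hv).2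
  have hε2 : ε ^ 2 ≤ 1 := pow_le_one₀ hε hε1
  let X : ℝ → ℝ := fun y => b * y + v * (y ^ 2 - 1)
  have hXi : Integrable X γ := by
    have h1 := ((ip 1).const_mul b).add (((ip 2).sub (ip 0)).const_mul v)
    exact h1.congr (ae_of_all _ fun y => by simp [X])
  have hX2e : (fun y => X y ^ 2) = fun y => v ^ 2 * y ^ 4 + 2 * b * v * y ^ 3
      + (b ^ 2 - 2 * v ^ 2) * y ^ 2 - 2 * b * v * y ^ 1 + v ^ 2 * y ^ 0 := by
    funext y; simp only [X]; ring
  have hX2i : Integrable (fun y => X y ^ 2) γ := by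
    rw [hX2e]
    exact (((((ip 4).const_mul _).add ((ip 3).const_mul _)).add ((ip 2).const_mul _)).sub
      ((ip 1).const_mul _)).add ((ip 0).const_mul _)
  have m1 : ∫ y : ℝ, y ^ 1 ∂γ = 0 := by
    simp only [pow_one]; exact integral_id_gaussianReal
  have m0 : ∫ y : ℝ, y ^ 0 ∂γ = 1 := by simp
  have hEX : ∫ y, X y ∂γ = 0 := by
    have : X = fun y => b * y ^ 1 + v * y ^ 2 - v * y ^ 0 := by funext y; simp only [X]; ring
    rw [this, integral_sub, integral_add, integral_const_mul, integral_const_mul,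
      integral_const_mul, m1, m2, m0]
    · ring
    all_goals first | exact (ip _).const_mul _ | exact ((ip _).const_mul _).add ((ip _).const_mul _)
  have hEX2 : ∫ y, X y ^ 2 ∂γ = b ^ 2 + 2 * v ^ 2 := by
    rw [hX2e, integral_add, integral_sub, integral_add, integral_add]
    · simp only [integral_const_mul]
      rw [m1, m2, m0, m3, m4]; ring
    · exact (ip _).const_mul _
    · exact (ip _).const_mul _
    · exact ((ip _).const_mul _).add ((ip _).const_mul _)
    · exact (ip _).const_mul _
    · exact (((ip _).const_mul _).add ((ip _).const_mul _)).add ((ip _).const_mul _)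
    · exact (ip _).const_mul _
    · exact (((((ip 4).const_mul _).add ((ip 3).const_mul _)).add ((ip 2).const_mul _)).sub
        ((ip 1).const_mul _))
    · exact (ip _).const_mul _
  have hX3 : ∀ y, |X y| ^ 3 ≤ M y := by
    intro y
    have : |X y| ≤ B * (1 + y ^ 2) + V * (y ^ 2 + 1) := by
      refine (abs_add_le _ _).trans ?_
      rw [abs_mul, abs_mul]
      gcongr
      · rw [abs_le]; constructor <;> nlinarith [sq_nonneg (y - 1), sq_nonneg (y + 1)]
      · rw [abs_le]; constructor <;> nlinarith [sq_nonneg y]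
    exact pow_le_pow_left₀ (abs_nonneg _) this 3
  have hEi : Integrable (fun y => Complex.exp (((ε * X y : ℝ) : ℂ) * Complex.I)) γ := by
    refine Integrable.of_bound (C := 1) (by simp only [X]; fun_prop) (ae_of_all _ fun y => ?_)
    rw [Complex.norm_exp_ofReal_mul_I]
  let T : ℝ → ℂ := fun y => 1 + ((ε * X y : ℝ) : ℂ) * Complex.I - ((ε * X y : ℝ) : ℂ) ^ 2 / 2
  have hTe : T = fun y => ((1 : ℝ) : ℂ) + (ε * Complex.I) * ((X y : ℝ) : ℂ)
      - (ε ^ 2 / 2 : ℂ) * ((X y ^ 2 : ℝ) : ℂ) := by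
    funext y; simp only [T]; push_cast; ring
  have hTi : Integrable T γ := by
    rw [hTe]
    exact ((integrable_const _).add (hXi.ofReal.const_mul _)).sub (hX2i.ofReal.const_mul _)
  have hET : ∫ y, T y ∂γ = ((1 - ε ^ 2 * (b ^ 2 / 2 + v ^ 2) : ℝ) : ℂ) := by
    rw [hTe, integral_sub, integral_add, integral_const_mul, integral_const_mul,
      integral_complex_ofReal, integral_complex_ofReal, integral_complex_ofReal, hEX, hEX2]
    · simp; ring
    · exact integrable_const _
    · exact hXi.ofReal.const_mul _
    · exact (integrable_const _).add (hXi.ofReal.const_mul _)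
    · exact hX2i.ofReal.const_mul _
  have hR : ‖∫ y, (Complex.exp (((ε * X y : ℝ) : ℂ) * Complex.I) - T y) ∂γ‖
      ≤ 4 * ε ^ 3 * ∫ y, M y ∂γ := by
    rw [← integral_const_mul]
    refine norm_integral_le_of_norm_le (hM.const_mul _) (ae_of_all _ fun y => ?_)
    refine (norm_cexp_I_sub_taylor_two (ε * X y)).trans ?_
    rw [abs_mul, mul_pow, abs_of_nonneg hε, mul_assoc]
    have := hX3 y
    have : ε ^ 3 * |X y| ^ 3 ≤ ε ^ 3 * M y := by gcongr
    linarith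
  set q : ℝ := ε ^ 2 * (b ^ 2 / 2 + v ^ 2) with hq
  have hq0 : 0 ≤ q := by positivity
  have hexpq : |Real.exp (-q) - (1 - q)| ≤ q ^ 2 := by
    rw [abs_le]
    constructor
    · nlinarith [Real.add_one_le_exp (-q), sq_nonneg q]
    · have h1 : Real.exp (-q) * Real.exp q = 1 := by rw [← Real.exp_add]; simp
      have h2 := Real.add_one_le_exp q
      have h3 : Real.exp (-q) ≤ 1 / (1 + q) := by
        rw [le_div_iff₀ (by positivity), ← h1]
        gcongr; linarith
      have h4 : 1 / (1 + q) ≤ 1 - q + q ^ 2 := by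
        rw [div_le_iff₀ (by positivity)]
        nlinarith [pow_nonneg hq0 3]
      linarith
  have hsplit : ∀ y, Complex.exp (((ε * (b * y + v * (y ^ 2 - 1)) : ℝ) : ℂ) * Complex.I
        + ((ε ^ 2 * v ^ 2 : ℝ) : ℂ)) - ((Real.exp (-(ε ^ 2 * b ^ 2 / 2)) : ℝ) : ℂ)
      = ((Real.exp (ε ^ 2 * v ^ 2) : ℝ) : ℂ) *
        ((Complex.exp (((ε * X y : ℝ) : ℂ) * Complex.I) - T y)
        + (T y - ((Real.exp (-q) : ℝ) : ℂ))) := by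
    intro y
    have : Real.exp (-(ε ^ 2 * b ^ 2 / 2)) = Real.exp (ε ^ 2 * v ^ 2) * Real.exp (-q) := by
      rw [← Real.exp_add]; congr 1; rw [hq]; ring
    rw [this, Complex.exp_add, Complex.ofReal_mul (Real.exp _), Complex.ofReal_exp (ε ^ 2 * v ^ 2)]
    ring
  have hdi : Integrable (fun y => Complex.exp (((ε * X y : ℝ) : ℂ) * Complex.I) - T y) γ :=
    hEi.sub hTi
  have hdj : Integrable (fun y => T y - ((Real.exp (-q) : ℝ) : ℂ)) γ :=
    hTi.sub (integrable_const _)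
  simp_rw [hsplit]
  rw [integral_const_mul, integral_add hdi hdj,
    integral_sub hTi (integrable_const _), hET, norm_mul]
  have n1 : ‖((Real.exp (ε ^ 2 * v ^ 2) : ℝ) : ℂ)‖ ≤ Real.exp (V ^ 2) := by
    rw [Complex.norm_real, Real.norm_of_nonneg (Real.exp_pos _).le]
    apply Real.exp_le_exp.2
    nlinarith [sq_nonneg v]
  have n2 : ‖((1 - q : ℝ) : ℂ) - ∫ _, ((Real.exp (-q) : ℝ) : ℂ) ∂γ‖ ≤ q ^ 2 := by
    rw [integral_const]
    simp only [probReal_univ, one_smul]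
    rw [← Complex.ofReal_sub, Complex.norm_real, Real.norm_eq_abs, abs_sub_comm]
    exact hexpq
  have hq2 : q ^ 2 ≤ ε ^ 3 * (B ^ 2 / 2 + V ^ 2) ^ 2 := by
    have h1 : (b ^ 2 / 2 + v ^ 2) ^ 2 ≤ (B ^ 2 / 2 + V ^ 2) ^ 2 := by gcongr
    have h2 : ε ^ 4 ≤ ε ^ 3 := pow_le_pow_of_le_one hε hε1 (by norm_num)
    calc q ^ 2 = ε ^ 4 * (b ^ 2 / 2 + v ^ 2) ^ 2 := by rw [hq]; ring
      _ ≤ _ := by gcongr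
  calc _ ≤ Real.exp (V ^ 2) * (4 * ε ^ 3 * |∫ y, M y ∂γ| + ε ^ 3 * (B ^ 2 / 2 + V ^ 2) ^ 2) := by
        gcongr
        refine (norm_add_le _ _).trans (add_le_add (hR.trans ?_) (n2.trans hq2))
        gcongr
        exact le_abs_self _
    _ = _ := by ring

lemma measurePreserving_update_pi {ι : Type*} [Fintype ι] [DecidableEq ι] (γ : Measure ℝ)
    [IsProbabilityMeasure γ] (k : ι) :
    MeasurePreserving (fun p : (ι → ℝ) × ℝ => Function.update p.1 k p.2)
      ((Measure.pi fun _ => γ).prod γ) (Measure.pi fun _ => γ) := by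
  have hm : Measurable (fun p : (ι → ℝ) × ℝ => Function.update p.1 k p.2) := by
    refine measurable_pi_lambda _ fun j => ?_
    by_cases h : j = k
    · subst h; simpa using measurable_snd
    · simp only [Function.update_of_ne h]; fun_prop
  refine ⟨hm, (Measure.pi_eq fun s hs => ?_).symm⟩
  rw [Measure.map_apply hm (MeasurableSet.univ_pi hs)]
  have : (fun p : (ι → ℝ) × ℝ => Function.update p.1 k p.2) ⁻¹' Set.univ.pi s
      = (Set.univ.pi (Function.update s k Set.univ)) ×ˢ s k := by
    ext p
    simp only [Set.mem_preimage, Set.mem_pi, Set.mem_univ, true_implies, Set.mem_prod]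
    constructor
    · intro h
      refine ⟨fun j => ?_, by simpa using h k⟩
      by_cases hj : j = k
      · subst hj; simp
      · simpa [hj] using h j
    · rintro ⟨h1, h2⟩ j
      by_cases hj : j = k
      · subst hj; simpa using h2
      · simpa [hj] using h1 j
  rw [this, Measure.prod_prod, Measure.pi_pi,
    ← Finset.mul_prod_erase Finset.univ _ (Finset.mem_univ k),
    ← Finset.mul_prod_erase Finset.univ (fun i => γ (s i)) (Finset.mem_univ k)]
  simp only [Function.update_self, measure_univ, one_mul]
  rw [mul_comm]
  congr 1
  refine Finset.prod_congr rfl fun j hj => ?_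
  rw [Function.update_of_ne (Finset.ne_of_mem_erase hj)]

/-- The compensated exponential of one Gaussian increment. -/
noncomputable def expStep (ε b v y : ℝ) : ℂ :=
  Complex.exp (((ε * (b * y + v * (y ^ 2 - 1)) : ℝ) : ℂ) * Complex.I + ((ε ^ 2 * v ^ 2 : ℝ) : ℂ))

lemma norm_expStep (ε b v y : ℝ) : ‖expStep ε b v y‖ = Real.exp (ε ^ 2 * v ^ 2) := by
  rw [expStep, Complex.exp_add, norm_mul, Complex.norm_exp_ofReal_mul_I, ← Complex.ofReal_exp,
    Complex.norm_real, Real.norm_of_nonneg (Real.exp_pos _).le, one_mul]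

@[fun_prop]
lemma Measurable.expStep {α : Type*} [MeasurableSpace α] {v y : α → ℝ} (ε b : ℝ)
    (hv : Measurable v) (hy : Measurable y) : Measurable fun x => expStep ε b (v x) (y x) := by
  unfold _root_.expStep; fun_prop

lemma norm_prod_expStep_le {ι : Type*} (S : Finset ι) (ε V : ℝ) (b v y : ι → ℝ)
    (hv : ∀ k, |v k| ≤ V) (hS : S.card * ε ^ 2 ≤ 1) :
    ‖∏ k ∈ S, expStep ε (b k) (v k) (y k)‖ ≤ Real.exp (V ^ 2) := by
  rw [norm_prod]
  simp_rw [norm_expStep]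
  rw [← Real.exp_sum]
  apply Real.exp_le_exp.2
  calc ∑ k ∈ S, ε ^ 2 * v k ^ 2 ≤ ∑ k ∈ S, ε ^ 2 * V ^ 2 := by
        exact Finset.sum_le_sum fun k _ => mul_le_mul_of_nonneg_left
          (sq_le_sq' (abs_le.1 (hv k)).1 (abs_le.1 (hv k)).2) (sq_nonneg ε)
    _ = (S.card * ε ^ 2) * V ^ 2 := by simp; ring
    _ ≤ 1 * V ^ 2 := by gcongr
    _ = V ^ 2 := one_mul _

/-- Telescoping estimate for products of compensated exponentials with weights that are
predictable for the ranking `r`. -/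
lemma norm_integral_prod_expStep_sub_le {ι : Type*} [Fintype ι] [DecidableEq ι] (r : ι → ℕ)
    (ε B V κ : ℝ) (hκ : 0 ≤ κ) (hε : 0 ≤ ε) (hε1 : ε ≤ 1)
    (hstep : ∀ ε b v : ℝ, 0 ≤ ε → ε ≤ 1 → |b| ≤ B → |v| ≤ V →
      ‖∫ y, (expStep ε b v y - ((Real.exp (-(ε ^ 2 * b ^ 2 / 2)) : ℝ) : ℂ)) ∂gaussianReal 0 1‖
        ≤ κ * ε ^ 3)
    (a : ι → (ι → ℝ) → ℝ) (ham : ∀ k, Measurable (a k)) (haV : ∀ k x, |a k x| ≤ V)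
    (hinv : ∀ j k, r j ≤ r k → ∀ x c, a j (Function.update x k c) = a j x)
    (b : ι → ℝ) (hb : ∀ k, |b k| ≤ B) (S : Finset ι) (hS : S.card * ε ^ 2 ≤ 1) :
    ‖∫ x, ∏ k ∈ S, expStep ε (b k) (a k x) (x k) ∂(Measure.pi fun _ : ι => gaussianReal 0 1)
      - ∏ k ∈ S, ((Real.exp (-(ε ^ 2 * b k ^ 2 / 2)) : ℝ) : ℂ)‖
      ≤ S.card * (κ * ε ^ 3 * Real.exp (V ^ 2)) := by
  induction S using Finset.induction_on_max_value r with
  | empty => simp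
  | insert k S hk hmax ih =>
    set π := (Measure.pi fun _ : ι => gaussianReal 0 1) with hπ
    have hcard : (insert k S).card = S.card + 1 := Finset.card_insert_of_notMem hk
    have hS' : S.card * ε ^ 2 ≤ 1 := by
      refine le_trans ?_ hS
      rw [hcard]; push_cast; nlinarith [sq_nonneg ε]
    specialize ih hS'
    simp only [Finset.prod_insert hk]
    let U : (ι → ℝ) → ℂ := fun x => ∏ k ∈ S, expStep ε (b k) (a k x) (x k)
    set β : ℂ := ((Real.exp (-(ε ^ 2 * b k ^ 2 / 2)) : ℝ) : ℂ) with hβ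
    have hβ1 : ‖β‖ ≤ 1 := by
      rw [hβ, Complex.norm_real, Real.norm_of_nonneg (Real.exp_pos _).le, Real.exp_le_one_iff]
      have : 0 ≤ ε ^ 2 * b k ^ 2 / 2 := by positivity
      linarith
    have hUm : Measurable U := by
      refine Finset.measurable_prod _ fun j _ => ?_
      have := ham j
      fun_prop
    have hUb : ∀ x, ‖U x‖ ≤ Real.exp (V ^ 2) := fun x =>
      norm_prod_expStep_le S ε V b _ x (fun k => haV k x) hS'
    have hUi : Integrable U π := Integrable.of_bound hUm.aestronglyMeasurable _ (ae_of_all _ hUb)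
    have hUinv : ∀ x c, U (Function.update x k c) = U x := by
      intro x c
      refine Finset.prod_congr rfl fun j hj => ?_
      have hjk : j ≠ k := fun h => hk (h ▸ hj)
      rw [hinv j k (hmax j hj), Function.update_of_ne hjk]
    have hgm : Measurable fun x : ι → ℝ => expStep ε (b k) (a k x) (x k) := by
      have := ham k
      fun_prop
    have hFm : Measurable fun x : ι → ℝ => (expStep ε (b k) (a k x) (x k) - β) * U x :=
      (hgm.sub_const _).mul hUm
    have hFb : ∀ x : ι → ℝ, ‖(expStep ε (b k) (a k x) (x k) - β) * U x‖
        ≤ (Real.exp (ε ^ 2 * V ^ 2) + 1) * Real.exp (V ^ 2) := by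
      intro x
      rw [norm_mul]
      gcongr
      · refine (norm_sub_le _ _).trans (add_le_add ?_ hβ1)
        rw [norm_expStep]
        exact Real.exp_le_exp.2 (mul_le_mul_of_nonneg_left
          (sq_le_sq' (abs_le.1 (haV k x)).1 (abs_le.1 (haV k x)).2) (sq_nonneg ε))
      · exact hUb x
    have hFi : Integrable (fun x : ι → ℝ => (expStep ε (b k) (a k x) (x k) - β) * U x) π :=
      Integrable.of_bound hFm.aestronglyMeasurable _ (ae_of_all _ hFb)
    have hupd := measurePreserving_update_pi (ι := ι) (gaussianReal 0 1) k
    have hmain : ‖∫ x, (expStep ε (b k) (a k x) (x k) - β) * U x ∂π‖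
        ≤ κ * ε ^ 3 * Real.exp (V ^ 2) := by
      have h1 : ∫ x, (expStep ε (b k) (a k x) (x k) - β) * U x ∂π
          = ∫ x, (∫ y, (expStep ε (b k) (a k x) y - β) ∂gaussianReal 0 1) * U x ∂π := by
        nth_rewrite 1 [hπ]
        rw [← hupd.map_eq, integral_map hupd.measurable.aemeasurable
          hFm.aestronglyMeasurable, integral_prod]
        · refine integral_congr_ae (ae_of_all _ fun x => ?_)
          simp only [hUinv, hinv k k le_rfl, Function.update_self]
          rw [integral_mul_const]
        · rw [← hupd.map_eq] at hπ
          rw [hπ] at hFi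
          exact hFi.comp_measurable hupd.measurable
      rw [h1]
      refine (norm_integral_le_of_norm_le_const (C := κ * ε ^ 3 * Real.exp (V ^ 2))
        (ae_of_all _ fun x => ?_)).trans (by simp)
      rw [norm_mul]
      gcongr
      · exact hstep ε (b k) (a k x) hε hε1 (hb k) (haV k x)
      · exact hUb x
    have hsplit : ∫ x, expStep ε (b k) (a k x) (x k) * U x ∂π
        = ∫ x, (expStep ε (b k) (a k x) (x k) - β) * U x ∂π + β * ∫ x, U x ∂π := by
      rw [← integral_const_mul, ← integral_add hFi (hUi.const_mul _)]
      congr 1; funext x; ring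
    change ‖∫ x, expStep ε (b k) (a k x) (x k) * U x ∂π - _‖ ≤ _
    rw [hsplit, add_sub_assoc, ← mul_sub]
    have hrest : ‖β * (∫ x, U x ∂π - ∏ k ∈ S, ((Real.exp (-(ε ^ 2 * b k ^ 2 / 2)) : ℝ) : ℂ))‖
        ≤ S.card * (κ * ε ^ 3 * Real.exp (V ^ 2)) := by
      rw [norm_mul]
      exact (mul_le_mul hβ1 ih (norm_nonneg _) zero_le_one).trans (by rw [one_mul])
    refine (norm_add_le _ _).trans ((add_le_add hmain hrest).trans ?_)
    rw [hcard]; push_cast; linarith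

lemma expStep_zero (ε b y : ℝ) :
    expStep ε b 0 y = Complex.exp (((ε * (b * y) : ℝ) : ℂ) * Complex.I) := by
  simp [expStep]

/-- Uniformly in the dimension, the compensated exponential is asymptotically uncorrelated with
exponentials of linear forms of the increments. -/
lemma exists_norm_integral_prod_expStep_sub_le (B V : ℝ) (hV : 0 ≤ V) :
    ∃ κ : ℝ, 0 ≤ κ ∧ ∀ {ι : Type} [Fintype ι] [DecidableEq ι] (r : ι → ℕ)
    (ε : ℝ), 0 ≤ ε → ε ≤ 1 → Fintype.card ι * ε ^ 2 ≤ 1 →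
    ∀ a : ι → (ι → ℝ) → ℝ, (∀ k, Measurable (a k)) → (∀ k x, |a k x| ≤ V) →
    (∀ j k, r j ≤ r k → ∀ x c, a j (Function.update x k c) = a j x) →
    ∀ b : ι → ℝ, (∀ k, |b k| ≤ B) →
    ‖∫ x, ∏ k, expStep ε (b k) (a k x) (x k) ∂(Measure.pi fun _ : ι => gaussianReal 0 1)
      - ∫ x, ∏ k, expStep ε (b k) 0 (x k) ∂(Measure.pi fun _ : ι => gaussianReal 0 1)‖ ≤ κ * ε := by
  obtain ⟨κ, hκ, hstep⟩ := exists_norm_gaussian_step_le B V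
  refine ⟨2 * (κ * Real.exp (V ^ 2)), by positivity, ?_⟩
  intro ι _ _ r ε hε hε1 hcard a ham haV hinv b hb
  have hS : ((Finset.univ : Finset ι).card : ℝ) * ε ^ 2 ≤ 1 := by simpa using hcard
  have h1 := norm_integral_prod_expStep_sub_le r ε B V κ hκ hε hε1 hstep a ham haV hinv b hb
    Finset.univ hS
  have h2 := norm_integral_prod_expStep_sub_le r ε B V κ hκ hε hε1 hstep (fun _ _ => 0)
    (fun _ => measurable_const) (fun _ _ => by simpa using hV) (fun _ _ _ _ _ => rfl) b hb
    Finset.univ hS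
  have h3 : ((Finset.univ : Finset ι).card : ℝ) * (κ * ε ^ 3 * Real.exp (V ^ 2))
      ≤ κ * Real.exp (V ^ 2) * ε := by
    calc _ = ((Finset.univ : Finset ι).card * ε ^ 2) * (κ * Real.exp (V ^ 2) * ε) := by ring
      _ ≤ 1 * (κ * Real.exp (V ^ 2) * ε) := by gcongr
      _ = _ := one_mul _
  rw [← sub_sub_sub_cancel_right _ _ (∏ k, ((Real.exp (-(ε ^ 2 * b k ^ 2 / 2)) : ℝ) : ℂ))]
  refine (norm_sub_le _ _).trans ?_
  linarith

lemma norm_integral_mul_le_eLpNorm {Ω : Type*} [MeasurableSpace Ω] {P : Measure Ω}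
    [IsProbabilityMeasure P] {E : Ω → ℂ} {M : ℝ} (hEM : ∀ ω, ‖E ω‖ ≤ M)
    {Z : Ω → ℝ} (hZ : MemLp Z 2 P) :
    ‖∫ ω, (Z ω : ℂ) * E ω ∂P‖ ≤ M * (eLpNorm Z 2 P).toReal := by
  have hM : 0 ≤ M := by
    obtain ⟨ω⟩ := Measure.nonempty_of_neZero P
    exact (norm_nonneg _).trans (hEM ω)
  have hZi : Integrable Z P := hZ.integrable (by norm_num)
  calc ‖∫ ω, (Z ω : ℂ) * E ω ∂P‖ ≤ ∫ ω, M * ‖Z ω‖ ∂P := by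
        refine norm_integral_le_of_norm_le (hZi.norm.const_mul M) (ae_of_all _ fun ω => ?_)
        rw [norm_mul, Complex.norm_real, mul_comm]
        gcongr
        exact hEM ω
    _ = M * (eLpNorm Z 1 P).toReal := by
        rw [integral_const_mul, integral_norm_eq_lintegral_enorm hZi.aestronglyMeasurable,
          eLpNorm_one_eq_lintegral_enorm]
    _ ≤ _ := by
        gcongr
        · exact hZ.2.ne
        · exact eLpNorm_le_eLpNorm_of_exponent_le (by norm_num) hZ.1

lemma integrable_ofReal_mul_of_bound {Ω : Type*} [MeasurableSpace Ω] {P : Measure Ω}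
    {E : Ω → ℂ} (hE : Measurable E) {M : ℝ} (hEM : ∀ ω, ‖E ω‖ ≤ M)
    {Z : Ω → ℝ} (hZ : Integrable Z P) : Integrable (fun ω => (Z ω : ℂ) * E ω) P :=
  hZ.ofReal.mul_bdd hE.aestronglyMeasurable (ae_of_all _ hEM)

/-- A bounded sequence converges weakly to zero as soon as it does so against a family of test
functions whose orthogonal complement is annihilated by the sequence. -/
lemma tendsto_integral_mul_zero_of_orthogonal {Ω : Type*} [MeasurableSpace Ω] (P : Measure Ω)
    [IsProbabilityMeasure P] (A : Set (Ω → ℝ)) (hA : ∀ g ∈ A, MemLp g 2 P)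
    (E : ℕ → Ω → ℂ) (hE : ∀ n, Measurable (E n)) (M : ℝ) (hEM : ∀ n ω, ‖E n ω‖ ≤ M)
    (hconv : ∀ g ∈ A, Tendsto (fun n => ∫ ω, (g ω : ℂ) * E n ω ∂P) atTop (𝓝 0))
    (horth : ∀ᶠ n in atTop, ∀ Z : Ω → ℝ, MemLp Z 2 P → (∀ g ∈ A, ∫ ω, g ω * Z ω ∂P = 0) →
      ∫ ω, (Z ω : ℂ) * E n ω ∂P = 0)
    (Z : Ω → ℝ) (hZ : MemLp Z 2 P) :
    Tendsto (fun n => ∫ ω, (Z ω : ℂ) * E n ω ∂P) atTop (𝓝 0) := by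
  have hbd : ∀ n (X : Lp ℝ 2 P), ‖∫ ω, (X ω : ℂ) * E n ω ∂P‖ ≤ M * ‖X‖ := fun n X => by
    rw [Lp.norm_def]
    exact norm_integral_mul_le_eLpNorm (hEM n) (Lp.memLp X)
  have hint : ∀ n (X : Lp ℝ 2 P), Integrable (fun ω => (X ω : ℂ) * E n ω) P := fun n X =>
    integrable_ofReal_mul_of_bound (hE n) (hEM n) ((Lp.memLp X).integrable (by norm_num))
  have hadd : ∀ n (X Y : Lp ℝ 2 P), ∫ ω, ((X + Y : Lp ℝ 2 P) ω : ℂ) * E n ω ∂P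
      = ∫ ω, (X ω : ℂ) * E n ω ∂P + ∫ ω, (Y ω : ℂ) * E n ω ∂P := by
    intro n X Y
    rw [← integral_add (hint n X) (hint n Y)]
    refine integral_congr_ae ?_
    filter_upwards [Lp.coeFn_add X Y] with ω h
    rw [h, Pi.add_apply]; push_cast; ring
  have hsmul : ∀ n (c : ℝ) (X : Lp ℝ 2 P), ∫ ω, ((c • X : Lp ℝ 2 P) ω : ℂ) * E n ω ∂P
      = c * ∫ ω, (X ω : ℂ) * E n ω ∂P := by
    intro n c X
    rw [← integral_const_mul]
    refine integral_congr_ae ?_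
    filter_upwards [Lp.coeFn_smul c X] with ω h
    rw [h, Pi.smul_apply, smul_eq_mul]; push_cast; ring
  let V : Submodule ℝ (Lp ℝ 2 P) :=
    { carrier := {X | Tendsto (fun n => ∫ ω, (X ω : ℂ) * E n ω ∂P) atTop (𝓝 0)}
      add_mem' := by
        intro X Y hX hY
        have := hX.add hY
        simpa only [Set.mem_ofPred_eq, hadd, add_zero] using this
      zero_mem' := by
        have h0 : ∀ n, ∫ ω, ((0 : Lp ℝ 2 P) ω : ℂ) * E n ω ∂P = 0 := fun n => by
          rw [← zero_smul ℝ (0 : Lp ℝ 2 P), hsmul, Complex.ofReal_zero, zero_mul]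
        simp only [Set.mem_ofPred_eq, h0, tendsto_const_nhds]
      smul_mem' := by
        intro c X hX
        have := hX.const_mul (c : ℂ)
        simpa only [Set.mem_ofPred_eq, hsmul, mul_zero] using this }
  have hVc : IsClosed (V : Set (Lp ℝ 2 P)) := by
    refine isClosed_of_closure_subset fun X hX => ?_
    change Tendsto (fun n => ∫ ω, (X ω : ℂ) * E n ω ∂P) atTop (𝓝 0)
    rw [Metric.tendsto_atTop]
    intro ε hε
    obtain ⟨Y, hY, hXY⟩ := Metric.mem_closure_iff.1 hX (ε / (2 * (|M| + 1))) (by positivity)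
    obtain ⟨n₀, hn₀⟩ := Metric.tendsto_atTop.1 hY (ε / 2) (by positivity)
    refine ⟨n₀, fun n hn => ?_⟩
    have h1 := hn₀ n hn
    rw [dist_zero_right] at h1 ⊢
    have h2 : X = (X - Y) + Y := by abel
    rw [h2, hadd]
    have h3 : ‖∫ ω, ((X - Y : Lp ℝ 2 P) ω : ℂ) * E n ω ∂P‖ ≤ ε / 2 := by
      refine (hbd n _).trans ?_
      rw [dist_eq_norm] at hXY
      calc M * ‖X - Y‖ ≤ (|M| + 1) * (ε / (2 * (|M| + 1))) := by
            gcongr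
            linarith [le_abs_self M]
        _ = ε / 2 := by field_simp
    calc _ ≤ _ := norm_add_le _ _
      _ < ε / 2 + ε / 2 := by linarith
      _ = ε := by ring
  let K :=
    (Submodule.span ℝ {X : Lp ℝ 2 P | ∃ g, ∃ h : g ∈ A, X = (hA g h).toLp g}).topologicalClosure
  have hKc : IsComplete (K : Set (Lp ℝ 2 P)) :=
    (Submodule.isClosed_topologicalClosure _).isComplete
  have hKV : K ≤ V := by
    refine Submodule.topologicalClosure_minimal _ (Submodule.span_le.2 ?_) hVc
    rintro X ⟨g, hg, rfl⟩
    refine (hconv g hg).congr fun n => integral_congr_ae ?_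
    filter_upwards [(hA g hg).coeFn_toLp] with ω h
    rw [h]
  have hKo : Kᗮ ≤ V := by
    intro X hX
    refine tendsto_const_nhds.congr' ?_
    filter_upwards [horth] with n hn
    refine (hn X (Lp.memLp X) fun g hg => ?_).symm
    have h1 : (hA g hg).toLp g ∈ K :=
      Submodule.le_topologicalClosure _ (Submodule.subset_span ⟨g, hg, rfl⟩)
    have h2 := (Submodule.mem_orthogonal K X).1 hX _ h1
    rw [L2.inner_def] at h2
    rw [← h2]
    refine integral_congr_ae ?_
    filter_upwards [(hA g hg).coeFn_toLp] with ω h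
    simp [h, mul_comm]
  have : K.HasOrthogonalProjection := by
    have : CompleteSpace K := hKc.completeSpace_coe
    infer_instance
  have htop : V = ⊤ := by
    rw [eq_top_iff, ← Submodule.sup_orthogonal_of_hasOrthogonalProjection (K := K)]
    exact sup_le hKV hKo
  have hmem : hZ.toLp Z ∈ V := htop ▸ Submodule.mem_top
  refine Tendsto.congr (fun n => integral_congr_ae ?_) hmem
  filter_upwards [hZ.coeFn_toLp] with ω h
  rw [h]

/-- A random variable orthogonal to all trigonometric functions of linear forms of a random
vector is orthogonal to all bounded measurable functions of this vector. -/
lemma integral_mul_comp_eq_zero_of_trig {Ω : Type*} [MeasurableSpace Ω] (P : Measure Ω)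
    {ι : Type*} [Fintype ι] (Y : Ω → ι → ℝ) (hY : Measurable Y)
    (Z : Ω → ℝ) (hZ : Integrable Z P)
    (hcos : ∀ c : ι → ℝ, ∫ ω, Real.cos (∑ k, c k * Y ω k) * Z ω ∂P = 0)
    (hsin : ∀ c : ι → ℝ, ∫ ω, Real.sin (∑ k, c k * Y ω k) * Z ω ∂P = 0)
    (G : (ι → ℝ) → ℂ) (hG : Measurable G) (M : ℝ) (hGM : ∀ x, ‖G x‖ ≤ M) :
    ∫ ω, (Z ω : ℂ) * G (Y ω) ∂P = 0 := by
  wlog hZm : Measurable Z generalizing Z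
  · have hae := hZ.aestronglyMeasurable.ae_eq_mk
    have hm := hZ.aestronglyMeasurable.stronglyMeasurable_mk.measurable
    have := this (hZ.aestronglyMeasurable.mk Z) (hZ.congr hae)
      (fun c => by
        rw [← hcos c]
        refine integral_congr_ae ?_
        filter_upwards [hae] with ω h; rw [h])
      (fun c => by
        rw [← hsin c]
        refine integral_congr_ae ?_
        filter_upwards [hae] with ω h; rw [h]) hm
    rw [← this]
    refine integral_congr_ae ?_
    filter_upwards [hae] with ω h; rw [h]
  let Y' : Ω → EuclideanSpace ℝ ι := fun ω => WithLp.toLp 2 (Y ω)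
  have hY' : Measurable Y' := by fun_prop
  let μ : (Ω → ℝ) → Measure (EuclideanSpace ℝ ι) := fun X =>
    (P.withDensity fun ω => ENNReal.ofReal (X ω)).map Y'
  have hfin : ∀ X, Integrable X P → IsFiniteMeasure (μ X) := by
    intro X hX
    have := isFiniteMeasure_withDensity_ofReal hX.2
    infer_instance
  have hμ : ∀ X : Ω → ℝ, Measurable X → ∀ F : EuclideanSpace ℝ ι → ℂ, Measurable F →
      ∫ y, F y ∂(μ X) = ∫ ω, ((max (X ω) 0 : ℝ) : ℂ) * F (Y' ω) ∂P := by
    intro X hX F hF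
    rw [integral_map hY'.aemeasurable hF.aestronglyMeasurable,
      integral_withDensity_eq_integral_toReal_smul (by fun_prop)
        (ae_of_all _ fun ω => ENNReal.ofReal_lt_top)]
    refine integral_congr_ae (ae_of_all _ fun ω => ?_)
    simp [ENNReal.toReal_ofReal', Complex.real_smul]
  have hdiff : ∀ F : EuclideanSpace ℝ ι → ℂ, Measurable F → (∃ M, ∀ y, ‖F y‖ ≤ M) →
      ∫ y, F y ∂(μ Z) - ∫ y, F y ∂(μ fun ω => -Z ω) = ∫ ω, (Z ω : ℂ) * F (Y' ω) ∂P := by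
    rintro F hF ⟨M, hM⟩
    have hFY : Measurable fun ω => F (Y' ω) := hF.comp hY'
    rw [hμ Z hZm F hF, hμ (fun ω => -Z ω) hZm.neg F hF, ← integral_sub]
    · refine integral_congr_ae (ae_of_all _ fun ω => ?_)
      have : (Z ω : ℂ) = ((max (Z ω) 0 : ℝ) : ℂ) - ((max (-Z ω) 0 : ℝ) : ℂ) := by
        rw [← Complex.ofReal_sub, max_zero_sub_max_neg_zero_eq_self]
      simp only [this]; ring
    · exact integrable_ofReal_mul_of_bound hFY (fun ω => hM _) hZ.pos_part
    · exact integrable_ofReal_mul_of_bound hFY (fun ω => hM _) hZ.neg.pos_part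
  have hfin1 := hfin Z hZ
  have hfin2 := hfin (fun ω => -Z ω) hZ.neg
  have heq : μ Z = μ fun ω => -Z ω := by
    refine Measure.ext_of_charFun ?_
    funext t
    rw [charFun_apply, charFun_apply, ← sub_eq_zero,
      hdiff (fun y => Complex.exp ((inner ℝ y t : ℝ) * Complex.I)) (by fun_prop)
        ⟨1, fun y => (Complex.norm_exp_ofReal_mul_I _).le⟩]
    have hin : ∀ ω, (inner ℝ (Y' ω) t : ℝ) = ∑ k, t k * Y ω k := by
      intro ω; simp [PiLp.inner_apply, Y']
    have hl : Measurable fun ω => ∑ k, t k * Y ω k := by fun_prop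
    have h1 : Integrable (fun ω => Real.cos (∑ k, t k * Y ω k) * Z ω) P :=
      hZ.bdd_mul (Real.measurable_cos.comp hl).aestronglyMeasurable (c := 1)
        (ae_of_all _ fun ω => Real.abs_cos_le_one _)
    have h2 : Integrable (fun ω => Real.sin (∑ k, t k * Y ω k) * Z ω) P :=
      hZ.bdd_mul (Real.measurable_sin.comp hl).aestronglyMeasurable (c := 1)
        (ae_of_all _ fun ω => Real.abs_sin_le_one _)
    have h3 : ∀ ω, (Z ω : ℂ) * Complex.exp ((inner ℝ (Y' ω) t : ℝ) * Complex.I)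
        = ((Real.cos (∑ k, t k * Y ω k) * Z ω : ℝ) : ℂ)
          + ((Real.sin (∑ k, t k * Y ω k) * Z ω : ℝ) : ℂ) * Complex.I := by
      intro ω
      rw [hin, Complex.exp_mul_I]
      push_cast; ring
    simp_rw [h3]
    rw [integral_add h1.ofReal (h2.ofReal.mul_const _), integral_mul_const,
      integral_complex_ofReal, integral_complex_ofReal, hcos, hsin]
    simp
  have := hdiff (fun y => G (WithLp.ofLp y)) (hG.comp (by fun_prop)) ⟨M, fun y => hGM _⟩
  rw [heq, sub_self] at this
  exact this.symm

section Sheet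

variable {Ω : Type*} [MeasurableSpace Ω] {P : Measure Ω} {W : ℝ × ℝ → Ω → ℝ}

lemma IsBrownianSheet.map_sum (hW : IsBrownianSheet P W) {ι : Type*} [Fintype ι] (z : ι → ℝ × ℝ)
    (hz : ∀ k, z k ∈ Set.Icc ((0:ℝ), (0:ℝ)) (1, 1)) (c : ι → ℝ) :
    P.map (fun ω => ∑ k, c k * W (z k) ω) = gaussianReal 0 (Real.toNNReal (∑ k, ∑ k', c k * c k' *
          (min (z k).1 (z k').1 * min (z k).2 (z k').2))) := by
  let e := (Fintype.equivFin ι).symm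
  have h := hW.2.2 (Fintype.card ι) (z ∘ e) (fun k => hz _) (c ∘ e)
  simp only [Function.comp_apply] at h
  convert h using 2
  · funext ω
    exact (e.sum_comp fun k => c k * W (z k) ω).symm
  · congr 1
    rw [← e.sum_comp]
    exact Finset.sum_congr rfl fun k _ => (e.sum_comp fun k' => c (e k) * c k' *
          (min (z (e k)).1 (z k').1 * min (z (e k)).2 (z k').2)).symm

lemma IsBrownianSheet.map_apply (hW : IsBrownianSheet P W) {z : ℝ × ℝ}
    (hz : z ∈ Set.Icc ((0:ℝ), (0:ℝ)) (1, 1)) :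
    P.map (W z) = gaussianReal 0 (Real.toNNReal (z.1 * z.2)) := by
  have := hW.map_sum (fun _ : Unit => z) (fun _ => hz) (fun _ => 1)
  simpa using this

lemma IsBrownianSheet.ae_eq_zero (hW : IsBrownianSheet P W) {z : ℝ × ℝ}
    (hz : z ∈ Set.Icc ((0:ℝ), (0:ℝ)) (1, 1)) (h0 : z.1 = 0 ∨ z.2 = 0) :
    ∀ᵐ ω ∂P, W z ω = 0 := by
  have h := hW.map_apply hz
  rw [mul_eq_zero.2 h0, Real.toNNReal_zero, gaussianReal_zero_var] at h
  have : ∀ᵐ x ∂(P.map (W z)), x = 0 := by rw [h, ae_dirac_eq]; exact rfl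
  exact ae_of_ae_map (hW.1 z).aemeasurable this

/-- The rectangle increment over the cell with lower-left corner `(i/n, j/n)`. -/
noncomputable def gridIncr {Ω : Type*} (W : ℝ × ℝ → Ω → ℝ) (n i j : ℕ) (ω : Ω) : ℝ :=
  W ((i : ℝ) / n, (j : ℝ) / n) ω + W (((i + 1 : ℕ) : ℝ) / n, ((j + 1 : ℕ) : ℝ) / n) ω
    - W ((i : ℝ) / n, ((j + 1 : ℕ) : ℝ) / n) ω - W (((i + 1 : ℕ) : ℝ) / n, (j : ℝ) / n) ω

/-- The rescaled increments over the `n × n` grid. -/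
noncomputable def stdIncr {Ω : Type*} (W : ℝ × ℝ → Ω → ℝ) (n : ℕ) (ω : Ω) (k : Fin n × Fin n) : ℝ :=
  n * gridIncr W n k.1 k.2 ω

lemma sum_range_gridIncr {Ω : Type*} (W : ℝ × ℝ → Ω → ℝ) (n p q : ℕ) (ω : Ω) :
    ∑ i ∈ Finset.range p, ∑ j ∈ Finset.range q, gridIncr W n i j ω
      = W ((p : ℝ) / n, (q : ℝ) / n) ω - W ((p : ℝ) / n, ((0 : ℕ) : ℝ) / n) ω
        - W (((0 : ℕ) : ℝ) / n, (q : ℝ) / n) ω + W (((0 : ℕ) : ℝ) / n, ((0 : ℕ) : ℝ) / n) ω := by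
  let g : ℕ → ℕ → ℝ := fun i j => W ((i : ℝ) / n, (j : ℝ) / n) ω
  have h1 : ∀ i, ∑ j ∈ Finset.range q, gridIncr W n i j ω
      = (g (i + 1) q - g (i + 1) 0) - (g i q - g i 0) := by
    intro i
    rw [← Finset.sum_range_sub (g (i + 1)), ← Finset.sum_range_sub (g i), ← Finset.sum_sub_distrib]
    refine Finset.sum_congr rfl fun j _ => ?_
    simp only [gridIncr, g]; ring
  simp_rw [h1]
  rw [Finset.sum_range_sub (fun i => g i q - g i 0)]
  simp only [g]; ring

lemma grid_mem_Icc {n i j : ℕ} (hi : i ≤ n) (hj : j ≤ n) :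
    (((i : ℝ) / n, (j : ℝ) / n) : ℝ × ℝ) ∈ Set.Icc ((0:ℝ), (0:ℝ)) (1, 1) := by
  refine ⟨⟨by positivity, by positivity⟩, ?_, ?_⟩ <;>
    exact div_le_one_of_le₀ (by exact_mod_cast ‹_›) (by positivity)

lemma sum_sign_mul_min (n : ℕ) (hn : 1 ≤ n) (i i' : ℕ) :
    ∑ e : Fin 2, ∑ e' : Fin 2, (-1 : ℝ) ^ (e : ℕ) * (-1 : ℝ) ^ (e' : ℕ) *
      min (((i + e : ℕ) : ℝ) / n) (((i' + e' : ℕ) : ℝ) / n) = (if i = i' then 1 else 0) / n := by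
  have hn' : (0 : ℝ) ≤ n := by positivity
  have h : ∀ a b : ℕ, min ((a : ℝ) / n) ((b : ℝ) / n) = ((min a b : ℕ) : ℝ) / n := by
    intro a b
    rw [min_div_div_right hn', Nat.cast_min]
  simp_rw [h]
  simp only [Fin.sum_univ_two, Fin.val_zero, Fin.val_one, pow_zero, pow_one, add_zero]
  have h2 : (min i i' : ℤ) - (min i (i' + 1) : ℤ) - (min (i + 1) i' : ℤ)
      + (min (i + 1) (i' + 1) : ℤ) = if i = i' then 1 else 0 := by
    split_ifs <;> omega
  have h3 : ((min i i' : ℕ) : ℝ) - ((min i (i' + 1) : ℕ) : ℝ) - ((min (i + 1) i' : ℕ) : ℝ)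
      + ((min (i + 1) (i' + 1) : ℕ) : ℝ) = if i = i' then 1 else 0 := by
    exact_mod_cast h2
  rw [← h3]; ring

lemma IsBrownianSheet.map_sum_stdIncr (hW : IsBrownianSheet P W) {n : ℕ} (hn : 1 ≤ n)
    (c : Fin n × Fin n → ℝ) :
    P.map (fun ω => ∑ k, c k * stdIncr W n ω k)
      = gaussianReal 0 (Real.toNNReal (∑ k, c k ^ 2)) := by
  let sg : Fin 2 → ℝ := fun e => (-1) ^ (e : ℕ)
  let z : (Fin n × Fin n) × (Fin 2 × Fin 2) → ℝ × ℝ := fun p =>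
    (((p.1.1 + p.2.1 : ℕ) : ℝ) / n, ((p.1.2 + p.2.2 : ℕ) : ℝ) / n)
  have hz : ∀ p, z p ∈ Set.Icc ((0:ℝ), (0:ℝ)) (1, 1) := fun p =>
    grid_mem_Icc (by omega) (by omega)
  have h := hW.map_sum z hz (fun p => c p.1 * n * (sg p.2.1 * sg p.2.2))
  convert h using 2
  · funext ω
    refine Eq.trans ?_ (Fintype.sum_prod_type (f := fun p : (Fin n × Fin n) × (Fin 2 × Fin 2) =>
      c p.1 * n * (sg p.2.1 * sg p.2.2) * W (z p) ω)).symm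
    refine Finset.sum_congr rfl fun k _ => ?_
    simp only [stdIncr, gridIncr, Fintype.sum_prod_type, Fin.sum_univ_two, z, sg, Fin.val_zero,
      Fin.val_one, pow_zero, pow_one, add_zero]
    ring
  · congr 1
    have hn' : (n : ℝ) ≠ 0 := by positivity
    have key : ∀ k k' : Fin n × Fin n, ∑ e : Fin 2 × Fin 2, ∑ e' : Fin 2 × Fin 2,
        c k * n * (sg e.1 * sg e.2) * (c k' * n * (sg e'.1 * sg e'.2)) *
          (min (z (k, e)).1 (z (k', e')).1 * min (z (k, e)).2 (z (k', e')).2)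
        = if k = k' then c k * c k' else 0 := by
      intro k k'
      have h1 := sum_sign_mul_min n hn k.1 k'.1
      have h2 := sum_sign_mul_min n hn k.2 k'.2
      have h3 : (if k = k' then c k * c k' else 0) = c k * c k' * n ^ 2 *
          (((if (k.1 : ℕ) = k'.1 then (1 : ℝ) else 0) / n)
            * ((if (k.2 : ℕ) = k'.2 then (1 : ℝ) else 0) / n)) := by
        simp only [Prod.ext_iff, Fin.ext_iff]
        by_cases ha : (k.1 : ℕ) = k'.1 <;> by_cases hb : (k.2 : ℕ) = k'.2 <;> simp [ha, hb]
        field_simp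
      rw [h3, ← h1, ← h2]
      simp only [Fintype.sum_prod_type, Fin.sum_univ_two, z, sg]
      ring
    calc ∑ k, c k ^ 2 = ∑ k, ∑ k', (if k = k' then c k * c k' else 0) := by
          simp [sq]
      _ = _ := by
          simp_rw [← key]
          rw [Fintype.sum_prod_type (f := fun p : (Fin n × Fin n) × (Fin 2 × Fin 2) => ∑ p',
            c p.1 * n * (sg p.2.1 * sg p.2.2) * (c p'.1 * n * (sg p'.2.1 * sg p'.2.2)) *
            (min (z p).1 (z p').1 * min (z p).2 (z p').2))]
          refine Finset.sum_congr rfl fun k _ => ?_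
          rw [Finset.sum_comm]
          refine Finset.sum_congr rfl fun e _ => ?_
          exact (Fintype.sum_prod_type (f := fun p' : (Fin n × Fin n) × (Fin 2 × Fin 2) =>
            c k * n * (sg e.1 * sg e.2) * (c p'.1 * n * (sg p'.2.1 * sg p'.2.2)) *
            (min (z (k, e)).1 (z p').1 * min (z (k, e)).2 (z p').2))).symm

lemma IsBrownianSheet.measurable_stdIncr (hW : IsBrownianSheet P W) (n : ℕ) :
    Measurable (stdIncr W n) := by
  have := hW.1
  refine measurable_pi_lambda _ fun k => ?_
  unfold stdIncr gridIncr
  fun_prop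

lemma IsBrownianSheet.map_stdIncr [IsProbabilityMeasure P] (hW : IsBrownianSheet P W) {n : ℕ}
    (hn : 1 ≤ n) : P.map (stdIncr W n) = Measure.pi fun _ => gaussianReal 0 1 := by
  have hm := hW.measurable_stdIncr n
  have : IsProbabilityMeasure (P.map (stdIncr W n)) :=
    Measure.isProbabilityMeasure_map hm.aemeasurable
  rw [← charFun_eq_pi_iff]
  intro t
  simp_rw [charFun_gaussianReal]
  rw [← Complex.exp_sum, charFun_apply, integral_map (by fun_prop) (by fun_prop),
    integral_map hm.aemeasurable (by fun_prop)]
  have h := congrArg (fun μ => charFun μ 1) (hW.map_sum_stdIncr hn t)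
  simp only [charFun_gaussianReal] at h
  rw [charFun_apply_real, integral_map (by fun_prop) (by fun_prop)] at h
  convert h using 1
  · refine integral_congr_ae (ae_of_all _ fun ω => ?_)
    simp [PiLp.inner_apply]
  · rw [Real.coe_toNNReal _ (Finset.sum_nonneg fun k _ => sq_nonneg _)]
    congr 1
    simp [Finset.sum_div]

end Sheet

section Mixing

/-- The value of the discretized sheet at `(p/n, q/n)` in terms of the rescaled increments. -/
noncomputable def gridVal (n p q : ℕ) (x : Fin n × Fin n → ℝ) : ℝ :=
  ∑ l : Fin n × Fin n, 1 / (n : ℝ) * ((if (l.1 : ℕ) < p ∧ (l.2 : ℕ) < q then 1 else 0) * x l)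

/-- The weight `u f(W)` of the cell `k`, for cells inside the `p × q` corner of the grid. -/
noncomputable def gridCoef (f : ℝ → ℝ) (u : ℝ) (n p q : ℕ) (k : Fin n × Fin n)
    (x : Fin n × Fin n → ℝ) : ℝ :=
  if (k.1 : ℕ) < p ∧ (k.2 : ℕ) < q then u * f (gridVal n k.1 k.2 x) else 0

/-- The normalized complex exponential of the weighted quadratic variation, as a function of the
rescaled increments. -/
noncomputable def gridExp (f : ℝ → ℝ) (u : ℝ) (n p q : ℕ) (x : Fin n × Fin n → ℝ) : ℂ :=
  ∏ k, expStep (1 / (n : ℝ)) 0 (gridCoef f u n p q k x) (x k)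

@[fun_prop]
lemma measurable_gridVal (n p q : ℕ) : Measurable (gridVal n p q) := by
  unfold gridVal; fun_prop

lemma measurable_gridCoef {f : ℝ → ℝ} (hf : Measurable f) (u : ℝ) (n p q : ℕ)
    (k : Fin n × Fin n) : Measurable (gridCoef f u n p q k) := by
  unfold gridCoef
  split_ifs
  · fun_prop
  · fun_prop

lemma abs_gridCoef_le {f : ℝ → ℝ} {C : ℝ} (hfC : ∀ x, |f x| ≤ C) (u : ℝ) (n p q : ℕ)
    (k : Fin n × Fin n) (x : Fin n × Fin n → ℝ) : |gridCoef f u n p q k x| ≤ |u| * C := by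
  have hC : 0 ≤ C := (abs_nonneg _).trans (hfC 0)
  unfold gridCoef
  split_ifs
  · rw [abs_mul]; gcongr; exact hfC _
  · rw [abs_zero]; positivity

lemma gridCoef_update (f : ℝ → ℝ) (u : ℝ) (n p q : ℕ) {j k : Fin n × Fin n}
    (hjk : (j.1 : ℕ) ≤ k.1) (x : Fin n × Fin n → ℝ) (c : ℝ) :
    gridCoef f u n p q j (Function.update x k c) = gridCoef f u n p q j x := by
  have h : gridVal n j.1 j.2 (Function.update x k c) = gridVal n j.1 j.2 x := by
    unfold gridVal
    refine Finset.sum_congr rfl fun l _ => ?_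
    by_cases hl : l = k
    · subst hl
      rw [if_neg (by omega)]; simp
    · rw [Function.update_of_ne hl]
  simp only [gridCoef, h]

lemma measurable_gridExp {f : ℝ → ℝ} (hf : Measurable f) (u : ℝ) (n p q : ℕ) :
    Measurable (gridExp f u n p q) := by
  unfold gridExp
  exact Finset.measurable_prod _ fun k _ =>
    Measurable.expStep _ _ (measurable_gridCoef hf u n p q k) (measurable_pi_apply k)

lemma card_mul_one_div_sq_le_one (n : ℕ) :
    (Fintype.card (Fin n × Fin n) : ℝ) * (1 / (n : ℝ)) ^ 2 ≤ 1 := by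
  rcases Nat.eq_zero_or_pos n with rfl | hn
  · simp
  · have : (n : ℝ) ≠ 0 := by positivity
    simp only [Fintype.card_prod, Fintype.card_fin]
    push_cast
    refine le_of_eq ?_
    field_simp

lemma norm_gridExp_le {f : ℝ → ℝ} {C : ℝ} (hfC : ∀ x, |f x| ≤ C) (u : ℝ) (n p q : ℕ)
    (x : Fin n × Fin n → ℝ) : ‖gridExp f u n p q x‖ ≤ Real.exp ((|u| * C) ^ 2) :=
  norm_prod_expStep_le Finset.univ _ _ _ _ _ (fun k => abs_gridCoef_le hfC u n p q k x)
    (card_mul_one_div_sq_le_one n)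

lemma prod_expStep_eq {ι : Type*} [Fintype ι] (ε : ℝ) (b v y : ι → ℝ) :
    ∏ k, expStep ε (b k) (v k) (y k)
      = Complex.exp (((∑ k, ε * (b k * y k) : ℝ) : ℂ) * Complex.I)
        * ∏ k, expStep ε 0 (v k) (y k) := by
  rw [Complex.ofReal_sum, Finset.sum_mul, Complex.exp_sum, ← Finset.prod_mul_distrib]
  refine Finset.prod_congr rfl fun k _ => ?_
  rw [expStep, expStep, ← Complex.exp_add]
  congr 1
  push_cast
  ring

variable {Ω : Type*} [MeasurableSpace Ω] {P : Measure Ω} {W : ℝ × ℝ → Ω → ℝ}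

lemma IsBrownianSheet.exists_norm_integral_gridExp_le [IsProbabilityMeasure P]
    (hW : IsBrownianSheet P W) {f : ℝ → ℝ} (hf : Measurable f) {C : ℝ} (hfC : ∀ x, |f x| ≤ C)
    (u B : ℝ) :
    ∃ κ : ℝ, ∀ n p q : ℕ, 1 ≤ n → ∀ b : Fin n × Fin n → ℝ, (∀ k, |b k| ≤ B) →
      ‖∫ ω, Complex.exp (((∑ k, 1 / (n : ℝ) * (b k * stdIncr W n ω k) : ℝ) : ℂ) * Complex.I)
        * (gridExp f u n p q (stdIncr W n ω) - 1) ∂P‖ ≤ κ * (1 / n) := by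
  have hC : 0 ≤ C := (abs_nonneg _).trans (hfC 0)
  obtain ⟨κ, -, hκ⟩ := exists_norm_integral_prod_expStep_sub_le B (|u| * C) (by positivity)
  refine ⟨κ, fun n p q hn b hb => ?_⟩
  have hn' : (1 : ℝ) ≤ n := by exact_mod_cast hn
  have hm := hW.measurable_stdIncr n
  have h := hκ (fun k : Fin n × Fin n => (k.1 : ℕ)) (1 / (n : ℝ)) (by positivity)
    (div_le_one_of_le₀ hn' (by positivity)) (card_mul_one_div_sq_le_one n)
    (gridCoef f u n p q) (measurable_gridCoef hf u n p q) (abs_gridCoef_le hfC u n p q)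
    (fun j k hjk x c => gridCoef_update f u n p q hjk x c) b hb
  have hmeas : ∀ v : Fin n × Fin n → (Fin n × Fin n → ℝ) → ℝ, (∀ k, Measurable (v k)) →
      Measurable fun x => ∏ k, expStep (1 / (n : ℝ)) (b k) (v k x) (x k) := fun v hv =>
    Finset.measurable_prod _ fun k _ => Measurable.expStep _ _ (hv k) (measurable_pi_apply k)
  have hbd : ∀ v : Fin n × Fin n → (Fin n × Fin n → ℝ) → ℝ, (∀ k x, |v k x| ≤ |u| * C) →
      ∀ x, ‖∏ k, expStep (1 / (n : ℝ)) (b k) (v k x) (x k)‖ ≤ Real.exp ((|u| * C) ^ 2) :=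
    fun v hv x => norm_prod_expStep_le Finset.univ _ _ _ _ _ (fun k => hv k x)
      (card_mul_one_div_sq_le_one n)
  have hm1 := hmeas _ (measurable_gridCoef hf u n p q)
  have hm2 := hmeas (fun _ _ => 0) (fun _ => measurable_const)
  rw [← integral_sub (Integrable.of_bound hm1.aestronglyMeasurable _
      (ae_of_all _ (hbd _ (abs_gridCoef_le hfC u n p q))))
    (Integrable.of_bound hm2.aestronglyMeasurable _
      (ae_of_all _ (hbd (fun _ _ => 0) (fun _ _ => by rw [abs_zero]; positivity)))),
    ← hW.map_stdIncr hn, integral_map hm.aemeasurable (hm1.fun_sub hm2).aestronglyMeasurable] at h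
  refine le_trans (le_of_eq ?_) h
  congr 1
  refine integral_congr_ae (ae_of_all _ fun ω => ?_)
  simp only
  rw [prod_expStep_eq, prod_expStep_eq (v := fun _ => 0)]
  simp only [expStep_zero, zero_mul, mul_zero, Complex.ofReal_zero, Complex.exp_zero,
    Finset.prod_const_one, mul_sub, mul_one, gridExp]

lemma sum_fin_prod_ite_lt {M : Type*} [AddCommMonoid M] {n p q : ℕ} (hp : p ≤ n) (hq : q ≤ n)
    (F : ℕ → ℕ → M) :
    ∑ k : Fin n × Fin n, (if (k.1 : ℕ) < p ∧ (k.2 : ℕ) < q then F k.1 k.2 else 0)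
      = ∑ i ∈ Finset.range p, ∑ j ∈ Finset.range q, F i j := by
  have e : ∀ m ≤ n, ∀ g : ℕ → M, ∑ i : Fin n, (if (i : ℕ) < m then g i else 0)
      = ∑ i ∈ Finset.range m, g i := by
    intro m hm g
    rw [Fin.sum_univ_eq_sum_range (fun i => if i < m then g i else 0), ← Finset.sum_filter]
    congr 1
    ext i; simp only [Finset.mem_filter, Finset.mem_range]; omega
  rw [Fintype.sum_prod_type, ← e p hp]
  refine Finset.sum_congr rfl fun i _ => ?_
  rw [← e q hq]
  split_ifs with hi <;> simp [hi]

lemma gridVal_stdIncr {Ω : Type*} {W : ℝ × ℝ → Ω → ℝ} {n p q : ℕ} (hn : 1 ≤ n) (hp : p ≤ n)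
    (hq : q ≤ n) {ω : Ω} (h1 : ∀ i : ℕ, i ≤ n → W ((i : ℝ) / n, 0) ω = 0)
    (h2 : ∀ i : ℕ, i ≤ n → W (0, (i : ℝ) / n) ω = 0) :
    gridVal n p q (stdIncr W n ω) = W ((p : ℝ) / n, (q : ℝ) / n) ω := by
  have hn' : (n : ℝ) ≠ 0 := by positivity
  have h3 := sum_range_gridIncr W n p q ω
  simp only [Nat.cast_zero, zero_div, h1 p hp, h2 q hq, show W (0, 0) ω = 0 by
    simpa using h1 0 (Nat.zero_le _), sub_zero, add_zero] at h3
  rw [← h3, gridVal, ← sum_fin_prod_ite_lt hp hq]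
  refine Finset.sum_congr rfl fun k _ => ?_
  rw [stdIncr]
  split_ifs
  · field_simp
  · simp

lemma tendsto_floor_mul_div {x : ℝ} (hx : 0 ≤ x) :
    Tendsto (fun n : ℕ => (⌊(n : ℝ) * x⌋₊ : ℝ) / n) atTop (𝓝 x) := by
  have := (tendsto_nat_floor_mul_div_atTop hx).comp (tendsto_natCast_atTop_atTop (R := ℝ))
  refine this.congr fun n => ?_
  simp [mul_comm]

lemma floor_mul_le {x : ℝ} (hx : x ≤ 1) (n : ℕ) : ⌊(n : ℝ) * x⌋₊ ≤ n := by
  refine Nat.floor_le_of_le ?_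
  exact mul_le_of_le_one_right (by positivity) hx

/-- Elements of the linear span of the sheet are limits of combinations of grid increments with
uniformly bounded coefficients. -/
lemma exists_tendsto_sum_stdIncr {Ω : Type*} {W : ℝ × ℝ → Ω → ℝ}
    (hc : ∀ ω, Continuous fun z => W z ω)
    (h1 : ∀ ω, ∀ n i : ℕ, i ≤ n → W ((i : ℝ) / n, 0) ω = 0)
    (h2 : ∀ ω, ∀ n i : ℕ, i ≤ n → W (0, (i : ℝ) / n) ω = 0)
    {X : Ω → ℝ} (hX : X ∈ Submodule.span ℝ (W '' Set.Icc ((0:ℝ), (0:ℝ)) (1, 1))) :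
    ∃ (B : ℝ) (b : ∀ n : ℕ, Fin n × Fin n → ℝ), (∀ n k, |b n k| ≤ B) ∧
      ∀ ω, Tendsto (fun n : ℕ => ∑ k, 1 / (n : ℝ) * (b n k * stdIncr W n ω k)) atTop
        (𝓝 (X ω)) := by
  induction hX using Submodule.span_induction with
  | mem X hX =>
    obtain ⟨z, hz, rfl⟩ := hX
    obtain ⟨⟨hz1, hz2⟩, hz3, hz4⟩ := hz
    refine ⟨1, fun n k => if (k.1 : ℕ) < ⌊(n : ℝ) * z.1⌋₊ ∧ (k.2 : ℕ) < ⌊(n : ℝ) * z.2⌋₊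
      then 1 else 0, fun n k => by dsimp only; split_ifs <;> simp, fun ω => ?_⟩
    have ht := ((hc ω).tendsto z).comp
      ((tendsto_floor_mul_div hz1).prodMk_nhds (tendsto_floor_mul_div hz2))
    refine ht.congr' ?_
    filter_upwards [eventually_ge_atTop 1] with n hn
    exact (gridVal_stdIncr hn (floor_mul_le hz3 n) (floor_mul_le hz4 n) (h1 ω n) (h2 ω n)).symm
  | zero => exact ⟨0, fun _ _ => 0, by simp, by simp⟩
  | add X Y _ _ hX hY =>
    obtain ⟨B, b, hb, h⟩ := hX
    obtain ⟨B', b', hb', h'⟩ := hY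
    refine ⟨B + B', fun n k => b n k + b' n k,
      fun n k => (abs_add_le _ _).trans (add_le_add (hb n k) (hb' n k)), fun ω => ?_⟩
    refine ((h ω).add (h' ω)).congr fun n => ?_
    rw [← Finset.sum_add_distrib]
    exact Finset.sum_congr rfl fun k _ => by ring
  | smul a X _ hX =>
    obtain ⟨B, b, hb, h⟩ := hX
    refine ⟨|a| * B, fun n k => a * b n k, fun n k => ?_, fun ω => ?_⟩
    · rw [abs_mul]; gcongr; exact hb n k
    · refine ((h ω).const_mul a).congr fun n => ?_
      rw [Finset.mul_sum]
      exact Finset.sum_congr rfl fun k _ => by ring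

lemma measurable_of_mem_span (hm : ∀ z, Measurable (W z)) {S : Set (ℝ × ℝ)} {X : Ω → ℝ}
    (hX : X ∈ Submodule.span ℝ (W '' S)) : Measurable X := by
  induction hX using Submodule.span_induction with
  | mem X hX => obtain ⟨z, -, rfl⟩ := hX; exact hm z
  | zero => exact measurable_const
  | add X Y _ _ hX hY => exact hX.add hY
  | smul a X _ hX => exact hX.const_smul a

lemma sum_stdIncr_mem_span {Ω : Type*} {W : ℝ × ℝ → Ω → ℝ} {n : ℕ} (c : Fin n × Fin n → ℝ) :
    (fun ω => ∑ k, c k * stdIncr W n ω k) ∈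
      Submodule.span ℝ (W '' Set.Icc ((0:ℝ), (0:ℝ)) (1, 1)) := by
  have hz : ∀ i j : ℕ, i ≤ n → j ≤ n → W ((i : ℝ) / n, (j : ℝ) / n) ∈
      Submodule.span ℝ (W '' Set.Icc ((0:ℝ), (0:ℝ)) (1, 1)) := fun i j hi hj =>
    Submodule.subset_span ⟨_, grid_mem_Icc hi hj, rfl⟩
  have : (fun ω => ∑ k, c k * stdIncr W n ω k) = ∑ k : Fin n × Fin n, (c k * n) •
      (W ((k.1 : ℕ) / n, (k.2 : ℕ) / n) + W (((k.1 + 1 : ℕ) : ℝ) / n, ((k.2 + 1 : ℕ) : ℝ) / n)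
        - W ((k.1 : ℕ) / n, ((k.2 + 1 : ℕ) : ℝ) / n)
        - W (((k.1 + 1 : ℕ) : ℝ) / n, (k.2 : ℕ) / n)) := by
    funext ω
    simp only [Finset.sum_apply, Pi.smul_apply, Pi.sub_apply, Pi.add_apply, smul_eq_mul, stdIncr,
      gridIncr, mul_assoc]
  rw [this]
  refine Submodule.sum_mem _ fun k _ => Submodule.smul_mem _ _ ?_
  exact Submodule.sub_mem _ (Submodule.sub_mem _ (Submodule.add_mem _
    (hz _ _ (by omega) (by omega)) (hz _ _ (by omega) (by omega)))
    (hz _ _ (by omega) (by omega))) (hz _ _ (by omega) (by omega))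

lemma IsBrownianSheet.tendsto_integral_exp_mul_gridExp [IsProbabilityMeasure P]
    (hW : IsBrownianSheet P W) (hc : ∀ ω, Continuous fun z => W z ω)
    (h1 : ∀ ω, ∀ n i : ℕ, i ≤ n → W ((i : ℝ) / n, 0) ω = 0)
    (h2 : ∀ ω, ∀ n i : ℕ, i ≤ n → W (0, (i : ℝ) / n) ω = 0)
    {f : ℝ → ℝ} (hf : Measurable f) {C : ℝ} (hfC : ∀ x, |f x| ≤ C) (u : ℝ) (p q : ℕ → ℕ)
    {X : Ω → ℝ} (hX : X ∈ Submodule.span ℝ (W '' Set.Icc ((0:ℝ), (0:ℝ)) (1, 1))) :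
    Tendsto (fun n => ∫ ω, Complex.exp ((X ω : ℂ) * Complex.I)
      * (gridExp f u n (p n) (q n) (stdIncr W n ω) - 1) ∂P) atTop (𝓝 0) := by
  obtain ⟨B, b, hb, hlim⟩ := exists_tendsto_sum_stdIncr hc h1 h2 hX
  obtain ⟨κ, hκ⟩ := hW.exists_norm_integral_gridExp_le hf hfC u B
  have hXm := measurable_of_mem_span hW.1 hX
  set Y : ℕ → Ω → ℝ := fun n ω => ∑ k, 1 / (n : ℝ) * (b n k * stdIncr W n ω k) with hY
  have hYm : ∀ n, Measurable (Y n) := fun n => by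
    have := fun k => (measurable_pi_apply k).comp (hW.measurable_stdIncr n)
    simp only [Function.comp_def] at this
    simp only [hY]
    fun_prop
  set M := Real.exp ((|u| * C) ^ 2) + 1 with hM
  have hEm : ∀ n, Measurable fun ω => gridExp f u n (p n) (q n) (stdIncr W n ω) - 1 := fun n =>
    ((measurable_gridExp hf u n _ _).comp (hW.measurable_stdIncr n)).sub_const 1
  have hEb : ∀ n ω, ‖gridExp f u n (p n) (q n) (stdIncr W n ω) - 1‖ ≤ M := fun n ω =>
    (norm_sub_le _ _).trans (by
      rw [norm_one]; exact add_le_add_left (norm_gridExp_le hfC u n _ _ _) 1)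
  have hnorm : ∀ x : ℝ, ‖Complex.exp ((x : ℂ) * Complex.I)‖ = 1 := Complex.norm_exp_ofReal_mul_I
  have hint : ∀ n (V : Ω → ℝ), Measurable V → Integrable (fun ω =>
      Complex.exp ((V ω : ℂ) * Complex.I) * (gridExp f u n (p n) (q n) (stdIncr W n ω) - 1)) P :=
    fun n V hV => by
      refine Integrable.of_bound (C := M) ?_ (ae_of_all _ fun ω => ?_)
      · have := hEm n
        exact Measurable.aestronglyMeasurable (by fun_prop)
      · rw [norm_mul, hnorm, one_mul]; exact hEb n ω
  have hA : Tendsto (fun n => ∫ ω, Complex.exp ((Y n ω : ℂ) * Complex.I)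
      * (gridExp f u n (p n) (q n) (stdIncr W n ω) - 1) ∂P) atTop (𝓝 0) := by
    refine squeeze_zero_norm' (a := fun n : ℕ => κ * (1 / (n : ℝ))) ?_ ?_
    · filter_upwards [eventually_ge_atTop 1] with n hn using hκ n _ _ hn (b n) (hb n)
    · simpa using tendsto_one_div_atTop_nhds_zero_nat.const_mul κ
  have hB : Tendsto (fun n => ∫ ω, (Complex.exp ((X ω : ℂ) * Complex.I)
      - Complex.exp ((Y n ω : ℂ) * Complex.I))
      * (gridExp f u n (p n) (q n) (stdIncr W n ω) - 1) ∂P) atTop (𝓝 0) := by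
    have h0 : (0 : ℂ) = ∫ ω, (0 : ℂ) ∂P := by simp
    rw [h0]
    refine tendsto_integral_of_dominated_convergence (fun _ => 2 * M) (fun n => ?_)
      (integrable_const _) (fun n => ae_of_all _ fun ω => ?_) (ae_of_all _ fun ω => ?_)
    · have := hEm n
      have := hYm n
      exact Measurable.aestronglyMeasurable (by fun_prop)
    · rw [norm_mul]
      refine mul_le_mul ((norm_sub_le _ _).trans ?_) (hEb n ω) (norm_nonneg _) (by norm_num)
      rw [hnorm, hnorm]; norm_num
    · have hcont : Continuous fun x : ℝ => Complex.exp ((x : ℂ) * Complex.I) := by fun_prop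
      have hd : Tendsto (fun n => Complex.exp ((X ω : ℂ) * Complex.I)
          - Complex.exp ((Y n ω : ℂ) * Complex.I)) atTop (𝓝 0) := by
        have := ((hcont.tendsto (X ω)).comp (hlim ω)).const_sub
          (Complex.exp ((X ω : ℂ) * Complex.I))
        rwa [sub_self] at this
      refine squeeze_zero_norm (a := fun n => ‖Complex.exp ((X ω : ℂ) * Complex.I)
          - Complex.exp ((Y n ω : ℂ) * Complex.I)‖ * M) (fun n => ?_)
        (by simpa only [norm_zero, zero_mul] using hd.norm.mul_const M)
      rw [norm_mul]
      gcongr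
      exact hEb n ω
  refine (by simpa using hA.add hB : Tendsto _ _ (𝓝 (0 : ℂ))).congr fun n => ?_
  simp only [sub_mul]
  rw [integral_sub (hint n X hXm) (hint n (Y n) (hYm n))]
  ring

/-- The normalized exponentials of the weighted quadratic variations converge weakly to one. -/
lemma IsBrownianSheet.tendsto_integral_mul_gridExp_sub_one [IsProbabilityMeasure P]
    (hW : IsBrownianSheet P W) (hc : ∀ ω, Continuous fun z => W z ω)
    (h1 : ∀ ω, ∀ n i : ℕ, i ≤ n → W ((i : ℝ) / n, 0) ω = 0)
    (h2 : ∀ ω, ∀ n i : ℕ, i ≤ n → W (0, (i : ℝ) / n) ω = 0)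
    {f : ℝ → ℝ} (hf : Measurable f) {C : ℝ} (hfC : ∀ x, |f x| ≤ C) (u : ℝ) (p q : ℕ → ℕ)
    {Z : Ω → ℝ} (hZ : MemLp Z 2 P) :
    Tendsto (fun n => ∫ ω, (Z ω : ℂ) *
      (gridExp f u n (p n) (q n) (stdIncr W n ω) - 1) ∂P) atTop (𝓝 0) := by
  set L := Submodule.span ℝ (W '' Set.Icc ((0:ℝ), (0:ℝ)) (1, 1)) with hL
  have hLm : ∀ X ∈ L, Measurable X := fun X hX => measurable_of_mem_span hW.1 hX
  have hEm : ∀ n, Measurable fun ω => gridExp f u n (p n) (q n) (stdIncr W n ω) - 1 := fun n =>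
    ((measurable_gridExp hf u n _ _).comp (hW.measurable_stdIncr n)).sub_const 1
  have hGb : ∀ n x, ‖gridExp f u n (p n) (q n) x - 1‖ ≤ Real.exp ((|u| * C) ^ 2) + 1 :=
    fun n x => (norm_sub_le _ _).trans (by
      rw [norm_one]; exact add_le_add_left (norm_gridExp_le hfC u n _ _ _) 1)
  have hlim := fun (X : Ω → ℝ) (hX : X ∈ L) =>
    hW.tendsto_integral_exp_mul_gridExp hc h1 h2 hf hfC u p q hX
  have hint : ∀ n (V : Ω → ℝ), Measurable V → Integrable (fun ω =>
      Complex.exp ((V ω : ℂ) * Complex.I) * (gridExp f u n (p n) (q n) (stdIncr W n ω) - 1)) P :=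
    fun n V hV => by
      refine Integrable.of_bound (C := Real.exp ((|u| * C) ^ 2) + 1) ?_ (ae_of_all _ fun ω => ?_)
      · have := hEm n
        exact Measurable.aestronglyMeasurable (by fun_prop)
      · rw [norm_mul, Complex.norm_exp_ofReal_mul_I, one_mul]; exact hGb n _
  refine tendsto_integral_mul_zero_of_orthogonal P
    ({g | ∃ X ∈ L, g = fun ω => Real.cos (X ω)} ∪ {g | ∃ X ∈ L, g = fun ω => Real.sin (X ω)})
    ?_ _ hEm _ (fun n ω => hGb n _) ?_ (Eventually.of_forall fun n => ?_) Z hZ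
  · rintro g (⟨X, hX, rfl⟩ | ⟨X, hX, rfl⟩) <;> have := hLm X hX
    · exact MemLp.of_bound (by fun_prop) 1 (ae_of_all _ fun ω => Real.abs_cos_le_one _)
    · exact MemLp.of_bound (by fun_prop) 1 (ae_of_all _ fun ω => Real.abs_sin_le_one _)
  · rintro g (⟨X, hX, rfl⟩ | ⟨X, hX, rfl⟩)
    · have h := ((hlim X hX).add (hlim (-X) (L.neg_mem hX))).mul_const (1 / 2)
      rw [add_zero, zero_mul] at h
      refine h.congr fun n => ?_
      rw [← integral_add (hint n _ (hLm X hX)) (hint n _ (hLm _ (L.neg_mem hX))),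
        ← integral_mul_const]
      refine integral_congr_ae (ae_of_all _ fun ω => ?_)
      simp only [Pi.neg_apply, Complex.ofReal_cos, Complex.cos, Complex.ofReal_neg]
      ring
    · have h := ((hlim (-X) (L.neg_mem hX)).sub (hlim X hX)).mul_const (Complex.I / 2)
      rw [sub_zero, zero_mul] at h
      refine h.congr fun n => ?_
      rw [← integral_sub (hint n _ (hLm _ (L.neg_mem hX))) (hint n _ (hLm X hX)),
        ← integral_mul_const]
      refine integral_congr_ae (ae_of_all _ fun ω => ?_)
      simp only [Pi.neg_apply, Complex.ofReal_sin, Complex.sin, Complex.ofReal_neg]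
      ring
  · intro Z hZ horth
    exact integral_mul_comp_eq_zero_of_trig P (stdIncr W n) (hW.measurable_stdIncr n) Z
      (hZ.integrable (by norm_num))
      (fun c => horth _ (Or.inl ⟨_, sum_stdIncr_mem_span c, rfl⟩))
      (fun c => horth _ (Or.inr ⟨_, sum_stdIncr_mem_span c, rfl⟩))
      (fun x => gridExp f u n (p n) (q n) x - 1)
      ((measurable_gridExp hf u n _ _).sub_const 1) _ (hGb n)

end Mixing

section Riemann

lemma integral_gaussianReal_le_of_nonneg {v : NNReal} (hv : v ≠ 0) (hv1 : v ≤ 1) {φ : ℝ → ℝ}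
    (hφ : Measurable φ) (hφ0 : ∀ x, 0 ≤ φ x) {M : ℝ} (hφM : ∀ x, φ x ≤ M) :
    ∫ x, φ x ∂gaussianReal 0 v ≤ (√(v : ℝ))⁻¹ * ∫ x, φ x ∂gaussianReal 0 1 := by
  have hb : ∀ x, ‖φ x‖ ≤ M := fun x => by rw [Real.norm_of_nonneg (hφ0 x)]; exact hφM x
  have hi : ∀ w : NNReal, Integrable (fun x => gaussianPDFReal 0 w x • φ x) := fun w =>
    (integrable_gaussianPDFReal 0 w).mul_bdd hφ.aestronglyMeasurable (ae_of_all _ hb)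
  rw [integral_gaussianReal_eq_integral_smul hv, integral_gaussianReal_eq_integral_smul one_ne_zero,
    ← integral_const_mul]
  refine integral_mono (hi v) ((hi 1).const_mul _) fun x => ?_
  have hv0 : (0 : ℝ) < v := by exact_mod_cast pos_iff_ne_zero.2 hv
  have hv1' : (v : ℝ) ≤ 1 := by exact_mod_cast hv1
  simp only [smul_eq_mul, ← mul_assoc]
  refine mul_le_mul_of_nonneg_right ?_ (hφ0 x)
  simp only [gaussianPDFReal_def, sub_zero, NNReal.coe_one, mul_one]
  rw [Real.sqrt_mul (by positivity) (v : ℝ), mul_inv, ← mul_assoc,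
    mul_comm (√(v : ℝ))⁻¹, neg_div, neg_div]
  gcongr
  linarith

variable {Ω : Type*} [MeasurableSpace Ω] {P : Measure Ω} {W : ℝ × ℝ → Ω → ℝ}

lemma IsBrownianSheet.integral_comp_le (hW : IsBrownianSheet P W) {z : ℝ × ℝ}
    (hz : z ∈ Set.Icc ((0:ℝ), (0:ℝ)) (1, 1)) {δ : ℝ} (hδ : 0 < δ) (hδz : δ ≤ z.1 * z.2)
    {φ : ℝ → ℝ} (hφ : Measurable φ) (hφ0 : ∀ x, 0 ≤ φ x) {M : ℝ} (hφM : ∀ x, φ x ≤ M) :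
    ∫ ω, φ (W z ω) ∂P ≤ (√δ)⁻¹ * ∫ x, φ x ∂gaussianReal 0 1 := by
  obtain ⟨⟨hz1, hz2⟩, hz3, hz4⟩ := hz
  simp only at hz1 hz2 hz3 hz4
  have h01 : z.1 * z.2 ≤ 1 := mul_le_one₀ hz3 hz2 hz4
  rw [← integral_map (hW.1 z).aemeasurable hφ.aestronglyMeasurable,
    hW.map_apply ⟨⟨hz1, hz2⟩, hz3, hz4⟩]
  refine (integral_gaussianReal_le_of_nonneg (Real.toNNReal_pos.2 (hδ.trans_le hδz)).ne'
    (Real.toNNReal_le_one.2 h01) hφ hφ0 hφM).trans ?_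
  rw [Real.coe_toNNReal _ (by positivity)]
  refine mul_le_mul_of_nonneg_right ?_ (integral_nonneg hφ0)
  gcongr

/-- Convergence in `L¹` of measurable functions of the sheet along converging interior points. -/
lemma IsBrownianSheet.tendsto_integral_abs_comp_sub [IsProbabilityMeasure P]
    (hW : IsBrownianSheet P W) (hc : ∀ ω, Continuous fun z => W z ω) {g : ℝ → ℝ}
    (hg : Measurable g) {M : ℝ} (hgM : ∀ x, |g x| ≤ M) {z : ℝ × ℝ}
    (hz : z ∈ Set.Icc ((0:ℝ), (0:ℝ)) (1, 1)) (hz0 : 0 < z.1 * z.2) {zn : ℕ → ℝ × ℝ}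
    (hzn : ∀ᶠ n in atTop, zn n ∈ Set.Icc ((0:ℝ), (0:ℝ)) (1, 1)) (hlim : Tendsto zn atTop (𝓝 z)) :
    Tendsto (fun n => ∫ ω, |g (W (zn n) ω) - g (W z ω)| ∂P) atTop (𝓝 0) := by
  set δ := z.1 * z.2 / 2 with hδ
  have hδ0 : 0 < δ := by positivity
  have hs : 0 < √δ := Real.sqrt_pos.2 hδ0
  have hev : ∀ᶠ n in atTop, δ ≤ (zn n).1 * (zn n).2 := by
    have : Tendsto (fun n => (zn n).1 * (zn n).2) atTop (𝓝 (z.1 * z.2)) :=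
      ((continuous_fst.tendsto z).comp hlim).mul ((continuous_snd.tendsto z).comp hlim)
    exact (this.eventually (lt_mem_nhds (by linarith : δ < z.1 * z.2))).mono fun n hn => hn.le
  rw [Metric.tendsto_atTop]
  intro ε hε
  have hgi : Integrable g (gaussianReal 0 1) :=
    Integrable.of_bound hg.aestronglyMeasurable M (ae_of_all _ hgM)
  obtain ⟨h, hgh, -⟩ := hgi.exists_boundedContinuous_integral_sub_le
    (ε := ε / 4 * √δ) (by positivity)
  have hhm : Measurable h := h.continuous.measurable
  have hhb : ∀ x, |h x| ≤ ‖h‖ := fun x => h.norm_coe_le_norm x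
  have hφm : Measurable fun x => |g x - h x| := by fun_prop
  have hφb : ∀ x, |g x - h x| ≤ M + ‖h‖ := fun x =>
    (abs_sub _ _).trans (add_le_add (hgM x) (hhb x))
  have happrox : ∀ w ∈ Set.Icc ((0:ℝ), (0:ℝ)) (1, 1), δ ≤ w.1 * w.2 →
      ∫ ω, |g (W w ω) - h (W w ω)| ∂P ≤ ε / 4 := fun w hw hδw => by
    refine (hW.integral_comp_le hw hδ0 hδw hφm (fun _ => abs_nonneg _) hφb).trans ?_
    calc (√δ)⁻¹ * ∫ x, |g x - h x| ∂gaussianReal 0 1 ≤ (√δ)⁻¹ * (ε / 4 * √δ) := by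
          gcongr; exact hgh
      _ = ε / 4 := by field_simp
  have hcont : Tendsto (fun n => ∫ ω, |h (W (zn n) ω) - h (W z ω)| ∂P) atTop (𝓝 0) := by
    have h0 : (0 : ℝ) = ∫ ω, (0 : ℝ) ∂P := by simp
    rw [h0]
    refine tendsto_integral_of_dominated_convergence (fun _ => ‖h‖ + ‖h‖) (fun n => ?_)
      (integrable_const _) (fun n => ae_of_all _ fun ω => ?_) (ae_of_all _ fun ω => ?_)
    · have h1 := hW.1 (zn n)
      have h2 := hW.1 z
      exact Measurable.aestronglyMeasurable (by fun_prop)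
    · rw [Real.norm_of_nonneg (abs_nonneg _)]
      exact (abs_sub _ _).trans (add_le_add (hhb _) (hhb _))
    · have := ((((h.continuous.comp (hc ω)).tendsto z).comp hlim).sub_const (h (W z ω))).abs
      simpa using this
  refine eventually_atTop.1 ?_
  filter_upwards [hzn, hev, hcont.eventually (gt_mem_nhds (by positivity : 0 < ε / 4))]
    with n hn1 hn2 hn3
  rw [dist_zero_right, Real.norm_of_nonneg (integral_nonneg fun _ => abs_nonneg _)]
  have hint : ∀ (φ : ℝ → ℝ) (ψ : ℝ → ℝ) (w w' : ℝ × ℝ) (A B : ℝ), Measurable φ → Measurable ψ →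
      (∀ x, |φ x| ≤ A) → (∀ x, |ψ x| ≤ B) →
      Integrable (fun ω => |φ (W w ω) - ψ (W w' ω)|) P := fun φ ψ w w' A B hφ hψ hA hB => by
    have h1 := hW.1 w
    have h2 := hW.1 w'
    refine Integrable.of_bound (C := A + B) (Measurable.aestronglyMeasurable (by fun_prop))
      (ae_of_all _ fun ω => ?_)
    rw [Real.norm_of_nonneg (abs_nonneg _)]
    exact (abs_sub _ _).trans (add_le_add (hA _) (hB _))
  have i1 := hint g h (zn n) (zn n) M ‖h‖ hg hhm hgM hhb
  have i2 := hint h h (zn n) z ‖h‖ ‖h‖ hhm hhm hhb hhb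
  have i3 := hint g h z z M ‖h‖ hg hhm hgM hhb
  calc ∫ ω, |g (W (zn n) ω) - g (W z ω)| ∂P
      ≤ ∫ ω, (|g (W (zn n) ω) - h (W (zn n) ω)| + |h (W (zn n) ω) - h (W z ω)|
          + |g (W z ω) - h (W z ω)|) ∂P := by
        refine integral_mono (hint g g (zn n) z M M hg hg hgM hgM) ((i1.add i2).add i3) fun ω => ?_
        dsimp only
        rw [abs_sub_comm (g (W z ω)) (h (W z ω))]
        refine le_trans (le_of_eq ?_) (abs_add_three _ _ _)
        congr 1
        ring
    _ = ∫ ω, |g (W (zn n) ω) - h (W (zn n) ω)| ∂P + ∫ ω, |h (W (zn n) ω) - h (W z ω)| ∂P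
          + ∫ ω, |g (W z ω) - h (W z ω)| ∂P := by
        rw [integral_add (i1.fun_add i2) i3, integral_add i1 i2]
    _ < ε := by
        have e1 := happrox _ hn1 hn2
        have e2 := happrox z hz (by rw [hδ]; linarith)
        linarith

lemma setIntegral_comp_floor {n : ℕ} (hn : 1 ≤ n) (h : ℕ → ℝ) (p : ℕ) :
    IntegrableOn (fun x : ℝ => h ⌊(n : ℝ) * x⌋₊) (Set.Ico 0 ((p : ℝ) / n)) ∧
      ∫ x in Set.Ico 0 ((p : ℝ) / n), h ⌊(n : ℝ) * x⌋₊
        = ∑ i ∈ Finset.range p, 1 / (n : ℝ) * h i := by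
  have hn' : (0 : ℝ) < n := by positivity
  induction p with
  | zero => simp
  | succ p ih =>
    have hle : (p : ℝ) / n ≤ ((p + 1 : ℕ) : ℝ) / n := by gcongr; simp
    have hcell : Set.EqOn (fun x : ℝ => h ⌊(n : ℝ) * x⌋₊) (fun _ => h p)
        (Set.Ico ((p : ℝ) / n) (((p + 1 : ℕ) : ℝ) / n)) := by
      rintro x ⟨hx1, hx2⟩
      rw [div_le_iff₀ hn'] at hx1
      rw [lt_div_iff₀ hn'] at hx2
      have : ⌊(n : ℝ) * x⌋₊ = p := by
        rw [Nat.floor_eq_iff (by nlinarith [(Nat.cast_nonneg p : (0 : ℝ) ≤ p)])]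
        constructor
        · linarith
        · push_cast at hx2; linarith
      simp only [this]
    have hint : IntegrableOn (fun x : ℝ => h ⌊(n : ℝ) * x⌋₊)
        (Set.Ico ((p : ℝ) / n) (((p + 1 : ℕ) : ℝ) / n)) :=
      (integrableOn_congr_fun hcell measurableSet_Ico).2 (integrableOn_const (by simp))
    rw [← Set.Ico_union_Ico_eq_Ico (by positivity : (0 : ℝ) ≤ (p : ℝ) / n) hle]
    refine ⟨ih.1.union hint, ?_⟩
    rw [setIntegral_union Set.Ico_disjoint_Ico_same measurableSet_Ico ih.1 hint, ih.2,
      setIntegral_congr_fun measurableSet_Ico hcell, Finset.sum_range_succ, setIntegral_const]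
    congr 1
    simp only [Measure.real, Real.volume_Ico, smul_eq_mul]
    rw [ENNReal.toReal_ofReal (by linarith)]
    push_cast
    ring

/-- Riemann sums over the grid as integrals of step functions. -/
lemma setIntegral_prod_comp_floor {n : ℕ} (hn : 1 ≤ n) (h : ℕ → ℕ → ℝ) {M : ℝ}
    (hM : ∀ i j, |h i j| ≤ M) (p q : ℕ) :
    ∫ ρ in Set.Ico (0 : ℝ) ((p : ℝ) / n) ×ˢ Set.Ico (0 : ℝ) ((q : ℝ) / n),
        h ⌊(n : ℝ) * ρ.1⌋₊ ⌊(n : ℝ) * ρ.2⌋₊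
      = ∑ i ∈ Finset.range p, ∑ j ∈ Finset.range q, 1 / (n : ℝ) * (1 / (n : ℝ) * h i j) := by
  have hm : Measurable fun ρ : ℝ × ℝ => h ⌊(n : ℝ) * ρ.1⌋₊ ⌊(n : ℝ) * ρ.2⌋₊ :=
    (measurable_of_countable (Function.uncurry h)).comp
      ((Nat.measurable_floor.comp (by fun_prop)).prodMk (Nat.measurable_floor.comp (by fun_prop)))
  rw [Measure.volume_eq_prod, setIntegral_prod]
  · simp only [(setIntegral_comp_floor hn _ q).2]
    rw [(setIntegral_comp_floor hn (fun i => ∑ j ∈ Finset.range q, 1 / (n : ℝ) * h i j) p).2]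
    simp only [Finset.mul_sum]
  · refine Measure.integrableOn_of_bounded (M := M) ?_ hm.aestronglyMeasurable
      (ae_of_all _ fun ρ => hM _ _)
    rw [Measure.prod_prod]
    exact ENNReal.mul_ne_top (by simp) (by simp)

/-- Riemann sums of a bounded measurable function of the sheet converge in `L¹`. -/
lemma IsBrownianSheet.tendsto_integral_abs_riemann_sub [IsProbabilityMeasure P]
    (hW : IsBrownianSheet P W) (hc : ∀ ω, Continuous fun z => W z ω) {g : ℝ → ℝ}
    (hg : Measurable g) {M : ℝ} (hgM : ∀ x, |g x| ≤ M) {s t : ℝ} (hs : s ∈ Set.Icc (0 : ℝ) 1)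
    (ht : t ∈ Set.Icc (0 : ℝ) 1) :
    Tendsto (fun n : ℕ => ∫ ω, |(∑ i ∈ Finset.range ⌊(n : ℝ) * s⌋₊,
      ∑ j ∈ Finset.range ⌊(n : ℝ) * t⌋₊,
        1 / (n : ℝ) * (1 / (n : ℝ) * g (W ((i : ℝ) / n, (j : ℝ) / n) ω)))
      - ∫ ρ in Set.Icc (0 : ℝ) s ×ˢ Set.Icc (0 : ℝ) t, g (W ρ ω)| ∂P) atTop (𝓝 0) := by
  have hM0 : 0 ≤ M := (abs_nonneg _).trans (hgM 0)
  have hWm : Measurable (Function.uncurry W) :=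
    measurable_uncurry_of_continuous_of_measurable hc hW.1
  let pt : ℕ → ℝ × ℝ → ℝ × ℝ := fun n ρ =>
    ((⌊(n : ℝ) * ρ.1⌋₊ : ℝ) / n, (⌊(n : ℝ) * ρ.2⌋₊ : ℝ) / n)
  have hpt : ∀ n, Measurable (pt n) := fun n => by
    have h1 : Measurable fun ρ : ℝ × ℝ => ⌊(n : ℝ) * ρ.1⌋₊ :=
      Nat.measurable_floor.comp (by fun_prop)
    have h2 : Measurable fun ρ : ℝ × ℝ => ⌊(n : ℝ) * ρ.2⌋₊ :=
      Nat.measurable_floor.comp (by fun_prop)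
    exact ((measurable_from_top.comp h1).div_const _).prodMk
      ((measurable_from_top.comp h2).div_const _)
  let S : ℕ → Set (ℝ × ℝ) := fun n =>
    Set.Ioo 0 ((⌊(n : ℝ) * s⌋₊ : ℝ) / n) ×ˢ Set.Ioo 0 ((⌊(n : ℝ) * t⌋₊ : ℝ) / n)
  have hSm : ∀ n, MeasurableSet (S n) := fun n => measurableSet_Ioo.prod measurableSet_Ioo
  let R : Set (ℝ × ℝ) := Set.Ioo 0 s ×ˢ Set.Ioo 0 t
  have hRm : MeasurableSet R := measurableSet_Ioo.prod measurableSet_Ioo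
  let ν : Measure (ℝ × ℝ) := volume.restrict R
  have hνf : IsFiniteMeasure ν := by
    refine ⟨?_⟩
    rw [Measure.restrict_apply_univ, Measure.volume_eq_prod, Measure.prod_prod]
    exact ENNReal.mul_lt_top (by simp) (by simp)
  let H : ℕ → ℝ × ℝ → Ω → ℝ := fun n ρ ω =>
    (S n).indicator (fun ρ => g (W (pt n ρ) ω)) ρ - g (W ρ ω)
  have hHm : ∀ n, Measurable (Function.uncurry (H n)) := fun n => by
    have h1 : Measurable fun x : (ℝ × ℝ) × Ω => g (W (pt n x.1) x.2) :=
      hg.comp (hWm.comp (((hpt n).comp measurable_fst).prodMk measurable_snd))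
    have h2 : Measurable fun x : (ℝ × ℝ) × Ω => g (W x.1 x.2) := hg.comp hWm
    exact (h1.indicator (measurable_fst (hSm n))).sub h2
  have hind : ∀ n ρ ω, |(S n).indicator (fun ρ => g (W (pt n ρ) ω)) ρ| ≤ M := fun n ρ ω => by
    rw [Set.indicator_apply]
    split_ifs
    · exact hgM _
    · rwa [abs_zero]
  have hHb : ∀ n ρ ω, |H n ρ ω| ≤ M + M := fun n ρ ω =>
    (abs_sub _ _).trans (add_le_add (hind n ρ ω) (hgM _))
  have hHi : ∀ n, Integrable (Function.uncurry fun ρ ω => |H n ρ ω|) (ν.prod P) := fun n => by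
    refine Integrable.of_bound (C := M + M) ?_ (ae_of_all _ fun x => ?_)
    · exact (continuous_abs.measurable.comp (hHm n)).aestronglyMeasurable
    · rw [Function.uncurry, Real.norm_of_nonneg (abs_nonneg _)]; exact hHb _ _ _
  have hfloor : ∀ (x : ℝ) (n : ℕ), 0 ≤ x → (⌊(n : ℝ) * x⌋₊ : ℝ) / n ≤ x := fun x n hx =>
    div_le_of_le_mul₀ (by positivity) hx (by
      rw [mul_comm x]; exact Nat.floor_le (by positivity))
  have hkey : ∀ᶠ n : ℕ in atTop, ∀ ω, (∑ i ∈ Finset.range ⌊(n : ℝ) * s⌋₊,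
      ∑ j ∈ Finset.range ⌊(n : ℝ) * t⌋₊,
        1 / (n : ℝ) * (1 / (n : ℝ) * g (W ((i : ℝ) / n, (j : ℝ) / n) ω)))
      - ∫ ρ in Set.Icc (0 : ℝ) s ×ˢ Set.Icc (0 : ℝ) t, g (W ρ ω) = ∫ ρ, H n ρ ω ∂ν := by
    filter_upwards [eventually_ge_atTop 1] with n hn ω
    have h1 : Measurable fun ρ => g (W (pt n ρ) ω) :=
      hg.comp ((hc ω).measurable.comp (hpt n))
    have h2 : Measurable fun ρ => g (W ρ ω) := hg.comp (hc ω).measurable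
    rw [integral_sub (Integrable.of_bound (h1.indicator (hSm n)).aestronglyMeasurable M
        (ae_of_all _ fun ρ => hind n ρ ω))
      (Integrable.of_bound h2.aestronglyMeasurable M (ae_of_all _ fun ρ => hgM _)),
      setIntegral_indicator (hSm n), Set.inter_eq_self_of_subset_right,
      ← setIntegral_prod_comp_floor hn (fun i j => g (W ((i : ℝ) / n, (j : ℝ) / n) ω))
        (fun i j => hgM _)]
    · congr 1
      · refine setIntegral_congr_set ?_
        rw [Measure.volume_eq_prod]
        exact (Measure.set_prod_ae_eq Ioo_ae_eq_Ico Ioo_ae_eq_Ico).symm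
      · refine setIntegral_congr_set ?_
        rw [Measure.volume_eq_prod]
        exact (Measure.set_prod_ae_eq Ioo_ae_eq_Icc Ioo_ae_eq_Icc).symm
    · exact Set.prod_mono (Set.Ioo_subset_Ioo_right (hfloor s n hs.1))
        (Set.Ioo_subset_Ioo_right (hfloor t n ht.1))
  have hlim : Tendsto (fun n => ∫ ρ, ∫ ω, |H n ρ ω| ∂P ∂ν) atTop (𝓝 0) := by
    have h0 : (0 : ℝ) = ∫ ρ, (0 : ℝ) ∂ν := by simp
    rw [h0]
    refine tendsto_integral_of_dominated_convergence (fun _ => M + M) (fun n => ?_)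
      (integrable_const _) (fun n => ae_of_all _ fun ρ => ?_) ?_
    · exact (StronglyMeasurable.integral_prod_right (f := fun ρ ω => |H n ρ ω|)
        (continuous_abs.measurable.comp (hHm n)).stronglyMeasurable).aestronglyMeasurable
    · rw [Real.norm_of_nonneg (integral_nonneg fun _ => abs_nonneg _)]
      calc ∫ ω, |H n ρ ω| ∂P ≤ ∫ ω, (M + M) ∂P :=
            integral_mono_of_nonneg (ae_of_all _ fun _ => abs_nonneg _) (integrable_const _)
              (ae_of_all _ fun ω => hHb n ρ ω)
        _ = M + M := by simp
    · filter_upwards [ae_restrict_mem hRm] with ρ hρ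
      obtain ⟨⟨h1, h2⟩, h3, h4⟩ := hρ
      have hI : ρ ∈ Set.Icc ((0:ℝ), (0:ℝ)) (1, 1) :=
        ⟨⟨h1.le, h3.le⟩, h2.le.trans hs.2, h4.le.trans ht.2⟩
      have hpl : Tendsto (fun n => pt n ρ) atTop (𝓝 ρ) :=
        (tendsto_floor_mul_div h1.le).prodMk_nhds (tendsto_floor_mul_div h3.le)
      refine (hW.tendsto_integral_abs_comp_sub hc hg hgM hI (mul_pos h1 h3)
        (Eventually.of_forall fun n => grid_mem_Icc (floor_mul_le hI.2.1 n)
          (floor_mul_le hI.2.2 n)) hpl).congr' ?_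
      filter_upwards [(tendsto_floor_mul_div hs.1).eventually (lt_mem_nhds h2),
        (tendsto_floor_mul_div ht.1).eventually (lt_mem_nhds h4)] with n hn1 hn2
      have : ρ ∈ S n := ⟨⟨h1, hn1⟩, h3, hn2⟩
      simp only [H, Set.indicator_of_mem this]
      rfl
  refine squeeze_zero' (Eventually.of_forall fun n => integral_nonneg fun _ => abs_nonneg _) ?_ hlim
  filter_upwards [hkey] with n hn
  rw [integral_integral_swap (hHi n)]
  refine integral_mono_of_nonneg (ae_of_all _ fun _ => abs_nonneg _)
    (hHi n).integral_prod_right (ae_of_all _ fun ω => ?_)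
  dsimp only
  rw [hn ω]
  exact abs_integral_le_integral_abs

end Riemann

section Assembly

lemma sum_Icc_one_eq_sum_range {M : Type*} [AddCommMonoid M] (F : ℕ → M) (p : ℕ) :
    ∑ i ∈ Finset.Icc 1 p, F i = ∑ i ∈ Finset.range p, F (i + 1) := by
  induction p with
  | zero => simp
  | succ p ih => rw [Finset.sum_Icc_succ_top (by omega), ih, Finset.sum_range_succ]

lemma abs_exp_neg_sub_exp_neg_le {a b : ℝ} (ha : 0 ≤ a) (hb : 0 ≤ b) :
    |Real.exp (-a) - Real.exp (-b)| ≤ |a - b| := by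
  wlog hab : a ≤ b generalizing a b
  · rw [abs_sub_comm, abs_sub_comm a]
    exact this hb ha (le_of_not_ge hab)
  rw [abs_of_nonneg (sub_nonneg.2 (Real.exp_le_exp.2 (by linarith))),
    abs_of_nonpos (sub_nonpos.2 hab)]
  have h1 : Real.exp (-b) = Real.exp (-a) * Real.exp (-(b - a)) := by
    rw [← Real.exp_add]; congr 1; ring
  have h2 := Real.add_one_le_exp (-(b - a))
  have h3 : Real.exp (-a) ≤ 1 := Real.exp_le_one_iff.2 (by linarith)
  rw [h1]
  nlinarith [Real.exp_pos (-a)]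

/-- The exponential of the weighted quadratic variation in terms of the normalized one. -/
lemma gridExp_stdIncr {Ω : Type*} {W : ℝ × ℝ → Ω → ℝ} (f : ℝ → ℝ) (u : ℝ) {n : ℕ} (hn : 1 ≤ n)
    {s t : ℝ} (hs : s ≤ 1) (ht : t ≤ 1) {ω : Ω}
    (h1 : ∀ i : ℕ, i ≤ n → W ((i : ℝ) / n, 0) ω = 0)
    (h2 : ∀ i : ℕ, i ≤ n → W (0, (i : ℝ) / n) ω = 0) :
    gridExp f u n ⌊(n : ℝ) * s⌋₊ ⌊(n : ℝ) * t⌋₊ (stdIncr W n ω)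
      = Complex.exp (Complex.I * (u : ℂ) * (wqv W f n s t ω : ℂ))
        * ((Real.exp (u ^ 2 * ∑ i ∈ Finset.range ⌊(n : ℝ) * s⌋₊, ∑ j ∈ Finset.range ⌊(n : ℝ) * t⌋₊,
          1 / (n : ℝ) * (1 / (n : ℝ) * f (W ((i : ℝ) / n, (j : ℝ) / n) ω) ^ 2)) : ℝ) : ℂ) := by
  have hn' : (n : ℝ) ≠ 0 := by positivity
  have hp := floor_mul_le hs n
  have hq := floor_mul_le ht n
  have hw : wqv W f n s t ω = ∑ i ∈ Finset.range ⌊(n : ℝ) * s⌋₊,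
      ∑ j ∈ Finset.range ⌊(n : ℝ) * t⌋₊, n * (f (W ((i : ℝ) / n, (j : ℝ) / n) ω) *
        (gridIncr W n i j ω ^ 2 - 1 / (n : ℝ) ^ 2)) := by
    simp only [wqv, sum_Icc_one_eq_sum_range, Finset.mul_sum, gridIncr]
    simp only [Nat.cast_add, Nat.cast_one, add_sub_cancel_right]
  rw [hw, Complex.ofReal_exp, ← Complex.exp_add, gridExp]
  simp only [expStep]
  rw [← Complex.exp_sum]
  congr 1
  rw [Finset.sum_add_distrib, ← Finset.sum_mul, ← Complex.ofReal_sum, ← Complex.ofReal_sum]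
  have e1 : ∑ k : Fin n × Fin n, 1 / (n : ℝ) * (0 * stdIncr W n ω k
      + gridCoef f u n ⌊(n : ℝ) * s⌋₊ ⌊(n : ℝ) * t⌋₊ k (stdIncr W n ω)
        * (stdIncr W n ω k ^ 2 - 1)) = u * ∑ i ∈ Finset.range ⌊(n : ℝ) * s⌋₊,
      ∑ j ∈ Finset.range ⌊(n : ℝ) * t⌋₊, n * (f (W ((i : ℝ) / n, (j : ℝ) / n) ω) *
        (gridIncr W n i j ω ^ 2 - 1 / (n : ℝ) ^ 2)) := by
    rw [← sum_fin_prod_ite_lt hp hq, Finset.mul_sum]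
    refine Finset.sum_congr rfl fun k _ => ?_
    rw [gridCoef, gridVal_stdIncr hn (by omega) (by omega) h1 h2, stdIncr]
    split_ifs
    · field_simp
      ring
    · ring
  have e2 : ∑ k : Fin n × Fin n, (1 / (n : ℝ)) ^ 2
      * gridCoef f u n ⌊(n : ℝ) * s⌋₊ ⌊(n : ℝ) * t⌋₊ k (stdIncr W n ω) ^ 2
      = u ^ 2 * ∑ i ∈ Finset.range ⌊(n : ℝ) * s⌋₊, ∑ j ∈ Finset.range ⌊(n : ℝ) * t⌋₊,
          1 / (n : ℝ) * (1 / (n : ℝ) * f (W ((i : ℝ) / n, (j : ℝ) / n) ω) ^ 2) := by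
    rw [← sum_fin_prod_ite_lt hp hq, Finset.mul_sum]
    refine Finset.sum_congr rfl fun k _ => ?_
    rw [gridCoef, gridVal_stdIncr hn (by omega) (by omega) h1 h2]
    split_ifs
    · ring
    · ring
  rw [e1, e2]
  push_cast
  ring

variable {Ω : Type*} [MeasurableSpace Ω] {P : Measure Ω} {W : ℝ × ℝ → Ω → ℝ}

lemma IsBrownianSheet.tendsto_integral_exp_wqv [IsProbabilityMeasure P]
    (hW : IsBrownianSheet P W) (hc : ∀ ω, Continuous fun z => W z ω)
    (h1 : ∀ ω, ∀ n i : ℕ, i ≤ n → W ((i : ℝ) / n, 0) ω = 0)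
    (h2 : ∀ ω, ∀ n i : ℕ, i ≤ n → W (0, (i : ℝ) / n) ω = 0)
    {f : ℝ → ℝ} (hf : Measurable f) {C : ℝ} (hfC : ∀ x, |f x| ≤ C)
    {s t : ℝ} (hs : s ∈ Set.Icc (0 : ℝ) 1) (ht : t ∈ Set.Icc (0 : ℝ) 1)
    {Z : Ω → ℝ} (hZ : Measurable Z) {K : ℝ} (hZK : ∀ ω, |Z ω| ≤ K) (u : ℝ) :
    Tendsto (fun n : ℕ => ∫ ω, (Z ω : ℂ) *
        Complex.exp (Complex.I * (u : ℂ) * (wqv W f n s t ω : ℂ)) ∂P) atTop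
      (𝓝 (∫ ω, (Z ω : ℂ) * Complex.exp (-(u : ℂ) ^ 2 *
          ((∫ ρ in Set.Icc (0:ℝ) s ×ˢ Set.Icc (0:ℝ) t, (f (W ρ ω)) ^ 2) : ℝ)) ∂P)) := by
  have hWm : Measurable (Function.uncurry W) :=
    measurable_uncurry_of_continuous_of_measurable hc hW.1
  set I : Ω → ℝ := fun ω => ∫ ρ in Set.Icc (0:ℝ) s ×ˢ Set.Icc (0:ℝ) t, (f (W ρ ω)) ^ 2 with hI
  have hIm : Measurable I := by
    refine (StronglyMeasurable.integral_prod_right (f := fun ω ρ => f (W ρ ω) ^ 2)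
      (Measurable.stronglyMeasurable ?_)).measurable
    exact (hf.comp (hWm.comp measurable_swap)).pow_const 2
  have hI0 : ∀ ω, 0 ≤ I ω := fun ω => integral_nonneg fun ρ => sq_nonneg _
  set Q : ℕ → Ω → ℝ := fun n ω => ∑ i ∈ Finset.range ⌊(n : ℝ) * s⌋₊,
    ∑ j ∈ Finset.range ⌊(n : ℝ) * t⌋₊,
      1 / (n : ℝ) * (1 / (n : ℝ) * f (W ((i : ℝ) / n, (j : ℝ) / n) ω) ^ 2) with hQ
  have hQm : ∀ n, Measurable (Q n) := fun n => by
    have := fun z => hf.comp (hW.1 z)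
    simp only [Function.comp_def] at this
    simp only [hQ]
    fun_prop
  have hQ0 : ∀ n ω, 0 ≤ Q n ω := fun n ω => by positivity
  set D : ℕ → Ω → ℂ := fun n ω => gridExp f u n ⌊(n : ℝ) * s⌋₊ ⌊(n : ℝ) * t⌋₊ (stdIncr W n ω)
    with hD
  have hDm : ∀ n, Measurable (D n) := fun n =>
    (measurable_gridExp hf u n _ _).comp (hW.measurable_stdIncr n)
  set M := Real.exp ((|u| * C) ^ 2) with hM
  have hDb : ∀ n ω, ‖D n ω‖ ≤ M := fun n ω => norm_gridExp_le hfC u n _ _ _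
  have hriem : Tendsto (fun n => ∫ ω, |Q n ω - I ω| ∂P) atTop (𝓝 0) :=
    hW.tendsto_integral_abs_riemann_sub hc (g := fun x => f x ^ 2) (hf.pow_const 2) (M := C ^ 2)
      (fun x => by rw [abs_pow]; gcongr; exact hfC x) hs ht
  have hfb : ∀ x, ‖f x ^ 2‖ ≤ C ^ 2 := fun x => by
    rw [norm_pow]
    exact pow_le_pow_left₀ (norm_nonneg _) (hfC x) 2
  have hIi : Integrable I P := by
    refine Integrable.of_bound hIm.aestronglyMeasurable _ (ae_of_all _ fun ω =>
      norm_setIntegral_le_of_norm_le_const ?_ fun ρ _ => hfb _)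
    rw [Measure.volume_eq_prod, Measure.prod_prod]
    exact ENNReal.mul_lt_top (by simp) (by simp)
  have hQi : ∀ n, Integrable (Q n) P := fun n =>
    integrable_finsetSum _ fun i _ => integrable_finsetSum _ fun j _ =>
      ((Integrable.of_bound ((hf.comp (hW.1 _)).pow_const 2).aestronglyMeasurable (C ^ 2)
        (ae_of_all _ fun ω => hfb _)).const_mul _).const_mul _
  have hQI : ∀ n, Integrable (fun ω => |Q n ω - I ω|) P := fun n => ((hQi n).sub hIi).abs
  set Z' : Ω → ℝ := fun ω => Z ω * Real.exp (-(u ^ 2 * I ω)) with hZ'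
  have hZ'm : Measurable Z' := by fun_prop
  have hexp1 : ∀ x : ℝ, 0 ≤ x → Real.exp (-(u ^ 2 * x)) ≤ 1 := fun x hx =>
    Real.exp_le_one_iff.2 (neg_nonpos.2 (by positivity))
  have hZ'K : ∀ ω, ‖Z' ω‖ ≤ K := fun ω => by
    rw [norm_mul, Real.norm_of_nonneg (Real.exp_pos _).le]
    exact (mul_le_of_le_one_right (norm_nonneg _) (hexp1 _ (hI0 ω))).trans (hZK ω)
  have hK : 0 ≤ K := by
    obtain ⟨ω⟩ := Measure.nonempty_of_neZero P
    exact (abs_nonneg _).trans (hZK ω)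
  have hweak : Tendsto (fun n => ∫ ω, (Z' ω : ℂ) * (D n ω - 1) ∂P) atTop (𝓝 0) :=
    hW.tendsto_integral_mul_gridExp_sub_one hc h1 h2 hf hfC u _ _
      (MemLp.of_bound hZ'm.aestronglyMeasurable K (ae_of_all _ hZ'K))
  have herr : Tendsto (fun n => ∫ ω, (Z ω : ℂ) * (D n ω *
      ((Real.exp (-(u ^ 2 * Q n ω)) - Real.exp (-(u ^ 2 * I ω)) : ℝ) : ℂ)) ∂P) atTop (𝓝 0) := by
    refine squeeze_zero_norm (a := fun n => K * (M * u ^ 2) * ∫ ω, |Q n ω - I ω| ∂P)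
      (fun n => ?_) (by simpa using hriem.const_mul (K * (M * u ^ 2)))
    rw [← integral_const_mul]
    refine norm_integral_le_of_norm_le ((hQI n).const_mul _) (ae_of_all _ fun ω => ?_)
    rw [norm_mul, norm_mul, Complex.norm_real, Complex.norm_real, Real.norm_eq_abs,
      Real.norm_eq_abs, mul_assoc, mul_assoc]
    have := abs_exp_neg_sub_exp_neg_le (mul_nonneg (sq_nonneg u) (hQ0 n ω))
      (mul_nonneg (sq_nonneg u) (hI0 ω))
    rw [← mul_sub, abs_mul, abs_of_nonneg (sq_nonneg u)] at this
    exact mul_le_mul (hZK ω) (mul_le_mul (hDb n ω) this (abs_nonneg _) (Real.exp_pos _).le)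
      (by positivity) hK
  have hlim : ∫ ω, (Z ω : ℂ) * Complex.exp (-(u : ℂ) ^ 2 * (I ω : ℝ)) ∂P
      = ∫ ω, (Z' ω : ℂ) ∂P := by
    refine integral_congr_ae (ae_of_all _ fun ω => ?_)
    simp only [hZ']
    push_cast
    ring_nf
  rw [hlim]
  have hsum := (herr.add hweak).add_const (∫ ω, (Z' ω : ℂ) ∂P)
  rw [add_zero, zero_add] at hsum
  refine hsum.congr' ?_
  filter_upwards [eventually_ge_atTop 1] with n hn
  have i1 : Integrable (fun ω => (Z ω : ℂ) * (D n ω *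
      ((Real.exp (-(u ^ 2 * Q n ω)) - Real.exp (-(u ^ 2 * I ω)) : ℝ) : ℂ))) P := by
    have := hDm n
    have := hQm n
    refine Integrable.of_bound (C := K * (M * (1 + 1)))
      (Measurable.aestronglyMeasurable (by fun_prop)) (ae_of_all _ fun ω => ?_)
    rw [norm_mul, norm_mul, Complex.norm_real, Complex.norm_real]
    refine mul_le_mul (hZK ω) (mul_le_mul (hDb n ω) ((norm_sub_le _ _).trans
      (add_le_add ?_ ?_)) (norm_nonneg _) (Real.exp_pos _).le) (by positivity) hK
    · rw [Real.norm_of_nonneg (Real.exp_pos _).le]; exact hexp1 _ (hQ0 n ω)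
    · rw [Real.norm_of_nonneg (Real.exp_pos _).le]; exact hexp1 _ (hI0 ω)
  have i3 : Integrable Z' P := Integrable.of_bound hZ'm.aestronglyMeasurable K (ae_of_all _ hZ'K)
  have i2 : Integrable (fun ω => (Z' ω : ℂ) * (D n ω - 1)) P :=
    integrable_ofReal_mul_of_bound ((hDm n).sub_const 1) (M := M + 1) (fun ω =>
      (norm_sub_le _ _).trans (by rw [norm_one]; exact add_le_add_left (hDb n ω) 1)) i3
  have i3' : Integrable (fun ω => (Z' ω : ℂ)) P := i3.ofReal
  rw [← integral_add i1 i2, ← integral_add (i1.fun_add i2) i3']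
  refine integral_congr_ae (ae_of_all _ fun ω => ?_)
  have hDe : Complex.exp (Complex.I * (u : ℂ) * (wqv W f n s t ω : ℂ))
      = D n ω * ((Real.exp (-(u ^ 2 * Q n ω)) : ℝ) : ℂ) := by
    simp only [hD, hQ]
    rw [gridExp_stdIncr f u hn hs.2 ht.2 (h1 ω n) (h2 ω n), mul_assoc (Complex.exp _),
      ← Complex.ofReal_mul (Real.exp _), ← Real.exp_add, add_neg_cancel, Real.exp_zero,
      Complex.ofReal_one, mul_one]
  simp only [hZ', hDe]
  push_cast
  ring

/-- A Brownian sheet has a modification, indistinguishable from it, all of whose paths are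
continuous and vanish at the grid points on the axes. -/
lemma IsBrownianSheet.exists_regular (hW : IsBrownianSheet P W) :
    ∃ W' : ℝ × ℝ → Ω → ℝ, IsBrownianSheet P W' ∧ (∀ᵐ ω ∂P, ∀ z, W' z ω = W z ω) ∧
      (∀ ω, Continuous fun z => W' z ω) ∧
      (∀ ω, ∀ n i : ℕ, i ≤ n → W' ((i : ℝ) / n, 0) ω = 0) ∧
      ∀ ω, ∀ n i : ℕ, i ≤ n → W' (0, (i : ℝ) / n) ω = 0 := by
  have hgood : ∀ᵐ ω ∂P, (Continuous fun z => W z ω) ∧ (∀ n i : ℕ, i ≤ n →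
      W ((i : ℝ) / n, 0) ω = 0) ∧ ∀ n i : ℕ, i ≤ n → W (0, (i : ℝ) / n) ω = 0 := by
    refine hW.2.1.and (Eventually.and ?_ ?_) <;>
      refine ae_all_iff.2 fun n => ae_all_iff.2 fun i => ?_ <;>
      by_cases hi : i ≤ n
    · filter_upwards [hW.ae_eq_zero (z := ((i : ℝ) / n, 0))
        (by simpa only [Nat.cast_zero, zero_div] using grid_mem_Icc hi (Nat.zero_le n))
        (Or.inr rfl)] with ω hω _ using hω
    · exact ae_of_all _ fun ω h => absurd h hi
    · filter_upwards [hW.ae_eq_zero (z := (0, (i : ℝ) / n))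
        (by simpa only [Nat.cast_zero, zero_div] using grid_mem_Icc (Nat.zero_le n) hi)
        (Or.inl rfl)] with ω hω _ using hω
    · exact ae_of_all _ fun ω h => absurd h hi
  obtain ⟨N, hN, hNm, hN0⟩ := exists_measurable_superset_of_null (ae_iff.1 hgood)
  have hNg : ∀ ω ∉ N, (Continuous fun z => W z ω) ∧ (∀ n i : ℕ, i ≤ n →
      W ((i : ℝ) / n, 0) ω = 0) ∧ ∀ n i : ℕ, i ≤ n → W (0, (i : ℝ) / n) ω = 0 := fun ω hω =>
    not_not.1 fun h => hω (hN h)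
  have hae : ∀ᵐ ω ∂P, ∀ z, Nᶜ.indicator (W z) ω = W z ω := by
    filter_upwards [measure_eq_zero_iff_ae_notMem.1 hN0] with ω hω z
    exact Set.indicator_of_mem hω _
  have hcont : ∀ ω, Continuous fun z => Nᶜ.indicator (W z) ω := fun ω => by
    by_cases hω : ω ∈ N
    · simp [hω, continuous_const]
    · simpa [hω] using (hNg ω hω).1
  refine ⟨fun z => Nᶜ.indicator (W z), ⟨fun z => (hW.1 z).indicator hNm.compl,
    ae_of_all _ hcont, fun m z hz c => ?_⟩, hae, hcont, fun ω n i hi => ?_, fun ω n i hi => ?_⟩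
  · rw [← hW.2.2 m z hz c]
    refine Measure.map_congr ?_
    filter_upwards [hae] with ω hω
    simp only [hω]
  · by_cases hω : ω ∈ N
    · simp [hω]
    · simpa [hω] using (hNg ω hω).2.1 n i hi
  · by_cases hω : ω ∈ N
    · simp [hω]
    · simpa [hω] using (hNg ω hω).2.2 n i hi

end Assembly

/-- F-stable convergence in law of the weighted quadratic variations process at a fixed point
`(s,t)` of `[0,1]²`, expressed through convergence of `E[Z exp(i u Xⁿ_(s,t))]` to
`E[Z exp(-u² ∫_{[0,s]×[0,t]} f(W_ρ)² dρ)]` for every bounded random variable `Z` and `u ∈ ℝ`. -/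
theorem stable_convergence_wqv_at_point
    {Ω : Type*} [MeasurableSpace Ω] (P : Measure Ω) [IsProbabilityMeasure P]
    (W : ℝ × ℝ → Ω → ℝ) (hW : IsBrownianSheet P W)
    (f : ℝ → ℝ) (hf : Measurable f) (C : ℝ) (hfC : ∀ x, |f x| ≤ C)
    (s t : ℝ) (hs : s ∈ Set.Icc (0:ℝ) 1) (ht : t ∈ Set.Icc (0:ℝ) 1)
    (Z : Ω → ℝ) (hZ : Measurable Z) (K : ℝ) (hZK : ∀ ω, |Z ω| ≤ K) (u : ℝ) :
    Tendsto
      (fun n : ℕ => ∫ ω, (Z ω : ℂ) *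
        Complex.exp (Complex.I * (u : ℂ) * (wqv W f n s t ω : ℂ)) ∂P)
      atTop
      (𝓝 (∫ ω, (Z ω : ℂ) *
        Complex.exp (-(u : ℂ) ^ 2 *
          ((∫ ρ in Set.Icc (0:ℝ) s ×ˢ Set.Icc (0:ℝ) t, (f (W ρ ω)) ^ 2) : ℝ)) ∂P)) := by
  obtain ⟨W', hW', hae, hc, h1, h2⟩ := hW.exists_regular
  have h := hW'.tendsto_integral_exp_wqv hc h1 h2 hf hfC hs ht hZ hZK u
  have hlim : ∫ ω, (Z ω : ℂ) * Complex.exp (-(u : ℂ) ^ 2 *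
        ((∫ ρ in Set.Icc (0:ℝ) s ×ˢ Set.Icc (0:ℝ) t, (f (W ρ ω)) ^ 2) : ℝ)) ∂P
      = ∫ ω, (Z ω : ℂ) * Complex.exp (-(u : ℂ) ^ 2 *
        ((∫ ρ in Set.Icc (0:ℝ) s ×ˢ Set.Icc (0:ℝ) t, (f (W' ρ ω)) ^ 2) : ℝ)) ∂P := by
    refine integral_congr_ae ?_
    filter_upwards [hae] with ω hω
    simp only [hω]
  rw [hlim]
  refine h.congr fun n => integral_congr_ae ?_
  filter_upwards [hae] with ω hω
  simp only [wqv, hω]
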